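/- arXiv:1107.2314 — 2 statements merged into one kernel-verified Lean document; each statement's English description precedes it below -/
import Mathlib

section
/- Let X be a set of 2n points in general position in the plane and let S be any set of at most n−1 edges of X. Then there exists a non-crossing perfect matching of X that avoids S, i.e., none of whose pairs belongs to S. -/
open MeasureTheory Set Filter

noncomputable section

abbrev Pt : Type := ℝ × ℝ

/-- A finite point set is in general position: no three distinct points are collinear. -/
def GenPos (X : Finset Pt) : Prop :=
  ∀ a ∈ X, ∀ b ∈ X, ∀ c ∈ X, a ≠ b → a ≠ c → b ≠ c → ¬ Collinear ℝ ({a, b, c} : Set Pt)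

/-- `e` is an edge of `X`: an unordered pair of distinct points of `X`. -/
def IsEdgeOf (X : Finset Pt) (e : Sym2 Pt) : Prop :=
  ¬ e.IsDiag ∧ ∀ p ∈ e, p ∈ X

/-- The closed segment joining the two points of an unordered pair. -/
def edgeSeg (e : Sym2 Pt) : Set Pt :=
  Sym2.lift ⟨fun u v => segment ℝ u v, fun u v => segment_symm ℝ u v⟩ e

/-- `M` is a non-crossing perfect matching of `X`: a partition of `X` into unordered pairs
whose closed segments are pairwise disjoint. -/
def IsNCMatching (X : Finset Pt) (M : Finset (Sym2 Pt)) : Prop :=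
  (∀ e ∈ M, IsEdgeOf X e) ∧
  (∀ p ∈ X, ∃! e, e ∈ M ∧ p ∈ e) ∧
  (M : Set (Sym2 Pt)).Pairwise fun e f => Disjoint (edgeSeg e) (edgeSeg f)

/-- The matching `M` avoids the edge set `S`. -/
def Avoids (M S : Finset (Sym2 Pt)) : Prop := ∀ e ∈ M, e ∉ S

/-- Every finite set of edges has at least `#X - #S` connected components on `X`: there is a
labelling constant along each edge that takes that many values on `X`. -/
lemma exists_labelling (X : Finset Pt) (S : Finset (Sym2 Pt)) :
    ∃ f : Pt → Pt, (∀ u v, s(u, v) ∈ S → f u = f v) ∧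
      X.card ≤ (X.image f).card + S.card := by
  classical
  induction S using Finset.induction_on with
  | empty => exact ⟨id, by simp, by simp⟩
  | insert e S he ih =>
    obtain ⟨f, hf, hcard⟩ := ih
    induction e using Sym2.ind with
    | _ u v =>
    refine ⟨fun p => if f p = f u then f v else f p, ?_, ?_⟩
    · intro a b hab
      rcases Finset.mem_insert.1 hab with h | h
      · rcases Sym2.eq_iff.1 h with ⟨rfl, rfl⟩ | ⟨rfl, rfl⟩ <;> simp
      · simp [hf a b h]
    · have hsub : (X.image f).erase (f u) ⊆
          X.image (fun p => if f p = f u then f v else f p) := by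
        intro k hk
        obtain ⟨hne, hk⟩ := Finset.mem_erase.1 hk
        obtain ⟨p, hp, rfl⟩ := Finset.mem_image.1 hk
        exact Finset.mem_image.2 ⟨p, hp, by simp [hne]⟩
      have h₁ := Finset.card_le_card hsub
      have h₂ := Finset.pred_card_le_card_erase (s := X.image f) (a := f u)
      rw [Finset.card_insert_of_notMem he]
      omega

/-- Among `n` natural numbers some nonempty subfamily has sum divisible by `n`. -/
lemma exists_subset_dvd_sum {ι : Type*} (n : ℕ) (hn : 0 < n) (s : Finset ι) (hs : n ≤ s.card)
    (w : ι → ℕ) : ∃ t ⊆ s, t.Nonempty ∧ n ∣ ∑ i ∈ t, w i := by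
  classical
  obtain ⟨e, he⟩ := Function.Embedding.exists_of_card_le_finset (α := Fin n) (s := s) (by simpa)
  let P : ℕ → Finset ι := fun i => (Finset.univ.filter fun j : Fin n => (j : ℕ) < i).map e
  have hPs : ∀ i, P i ⊆ s := by
    intro i x hx
    obtain ⟨j, -, rfl⟩ := Finset.mem_map.1 hx
    exact he ⟨j, rfl⟩
  have key : ∀ a b, a < b → b < n + 1 → (∑ i ∈ P a, w i) % n = (∑ i ∈ P b, w i) % n →
      ∃ t ⊆ s, t.Nonempty ∧ n ∣ ∑ i ∈ t, w i := by
    intro a b hab hb hmod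
    have hsub : P a ⊆ P b := by
      refine Finset.map_subset_map.2 fun j hj => ?_
      simp only [Finset.mem_filter, Finset.mem_univ, true_and] at hj ⊢
      omega
    refine ⟨P b \ P a, Finset.sdiff_subset.trans (hPs b), ⟨e ⟨a, by omega⟩, ?_⟩, ?_⟩
    · simp [P, hab]
    · have hsum := Finset.sum_sdiff hsub (f := w)
      have := (Nat.modEq_iff_dvd' (n := n) (by omega)).1 hmod
      rwa [← hsum, Nat.add_sub_cancel] at this
  obtain ⟨a, ha, b, hb, hab, hmod⟩ := Finset.exists_ne_map_eq_of_card_lt_of_maps_to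
    (s := Finset.range (n + 1)) (t := Finset.range n) (f := fun i => (∑ j ∈ P i, w j) % n)
    (by simp) (fun i _ => by simpa using Nat.mod_lt _ hn)
  rw [Finset.mem_range] at ha hb
  rcases lt_or_gt_of_ne hab with h | h
  · exact key a b h hb hmod
  · exact key b a h ha hmod.symm

/-- If a labelling of `2n` points takes more than `n` values, some union of label classes has
exactly `n` elements. -/
lemma exists_balanced_labels {α β : Type*} [DecidableEq β] (n : ℕ) (hn : 0 < n) (X : Finset α)
    (hX : X.card = 2 * n) (f : α → β) (hf : n + 1 ≤ (X.image f).card) :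
    ∃ T : Finset β, (X.filter fun p => f p ∈ T).card = n := by
  classical
  obtain ⟨k₀, hk₀⟩ : (X.image f).Nonempty := Finset.card_pos.1 (by omega)
  obtain ⟨T, hTs, hTne, hdvd⟩ := exists_subset_dvd_sum n hn ((X.image f).erase k₀)
    (by rw [Finset.card_erase_of_mem hk₀]; omega) (fun k => (X.filter fun p => f p = k).card)
  have hcard : (X.filter fun p => f p ∈ T).card = ∑ k ∈ T, (X.filter fun p => f p = k).card := by
    rw [Finset.card_eq_sum_card_fiberwise (f := f) (t := T) (fun p hp => by simp_all)]
    refine Finset.sum_congr rfl fun k hk => ?_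
    congr 1
    ext p
    simp only [Finset.mem_filter]
    constructor
    · rintro ⟨⟨h₁, -⟩, h₂⟩
      exact ⟨h₁, h₂⟩
    · rintro ⟨h₁, rfl⟩
      exact ⟨⟨h₁, hk⟩, rfl⟩
  refine ⟨T, ?_⟩
  have hpos : 0 < (X.filter fun p => f p ∈ T).card := by
    obtain ⟨k, hk⟩ := hTne
    obtain ⟨p, hp, rfl⟩ := Finset.mem_image.1 (Finset.mem_of_mem_erase (hTs hk))
    exact Finset.card_pos.2 ⟨p, Finset.mem_filter.2 ⟨hp, hk⟩⟩
  have hlt : (X.filter fun p => f p ∈ T).card < 2 * n := by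
    rw [← hX]
    obtain ⟨p, hp, rfl⟩ := Finset.mem_image.1 hk₀
    refine Finset.card_lt_card (Finset.filter_ssubset.2 ⟨p, hp, fun h => ?_⟩)
    exact Finset.notMem_erase _ _ (hTs h)
  rw [← hcard] at hdvd
  obtain ⟨c, hc⟩ := hdvd
  rw [hc] at hpos hlt ⊢
  have h₁ : 0 < c := Nat.pos_of_mul_pos_left hpos
  have h₂ : c < 2 := by nlinarith
  obtain rfl : c = 1 := by omega
  simp

/-- The Euclidean distance in the plane (the instance on `ℝ × ℝ` is the sup distance). -/
def euclDist (p q : Pt) : ℝ :=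
  dist (Complex.equivRealProdCLM.symm p) (Complex.equivRealProdCLM.symm q)

lemma euclDist_triangle (p q r : Pt) : euclDist p r ≤ euclDist p q + euclDist q r :=
  dist_triangle _ _ _

lemma euclDist_add_euclDist_eq_iff {p q r : Pt} :
    euclDist p q + euclDist q r = euclDist p r ↔ Wbtw ℝ p q r := by
  rw [euclDist, euclDist, euclDist, dist_add_dist_eq_iff]
  exact Function.Injective.wbtw_map_iff
    (f := (Complex.equivRealProdCLM.symm.toLinearEquiv.toLinearMap).toAffineMap)
    Complex.equivRealProdCLM.symm.injective

/-- Uncrossing: swapping the partners of two intersecting segments strictly decreases the total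
length, when no three of the four endpoints are collinear. -/
lemma euclDist_swap_lt {a b c d x : Pt} (hx₁ : Wbtw ℝ a x b) (hx₂ : Wbtw ℝ c x d)
    (habd : ¬ Collinear ℝ ({a, b, d} : Set Pt)) (hcda : ¬ Collinear ℝ ({c, d, a} : Set Pt)) :
    euclDist a d + euclDist c b < euclDist a b + euclDist c d := by
  have h₁ := euclDist_add_euclDist_eq_iff.2 hx₁
  have h₂ := euclDist_add_euclDist_eq_iff.2 hx₂
  have h₃ := euclDist_triangle a x d
  have h₄ := euclDist_triangle c x b
  rcases h₃.lt_or_eq with h | h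
  · linarith
  exfalso
  have hw : Wbtw ℝ a x d := euclDist_add_euclDist_eq_iff.1 h.symm
  by_cases hxa : x = a
  · subst hxa
    refine hcda ?_
    have := hx₂.collinear
    rwa [show ({c, d, x} : Set Pt) = {c, x, d} by rw [Set.pair_comm]]
  · refine habd ?_
    refine collinear_iff_of_mem (p₀ := a) (by simp) |>.2 ⟨x - a, ?_⟩
    have aux : ∀ q : Pt, Wbtw ℝ a x q → ∃ r : ℝ, q = r • (x - a) +ᵥ a := by
      rintro q ⟨t, -, ht⟩
      rw [AffineMap.lineMap_apply, vsub_eq_sub, vadd_eq_add] at ht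
      have ht0 : t ≠ 0 := by
        rintro rfl
        exact hxa (by simpa using ht.symm)
      refine ⟨t⁻¹, ?_⟩
      rw [← ht, vadd_eq_add, add_sub_cancel_right, smul_smul, inv_mul_cancel₀ ht0, one_smul,
        sub_add_cancel]
    rintro p (rfl | rfl | rfl)
    · exact ⟨0, by simp⟩
    · exact aux _ hx₁
    · exact aux _ hw

/-- Two disjoint equinumerous point sets in general position admit a bijection whose segments are
pairwise disjoint. -/
lemma exists_noncrossing_equiv (R B : Finset Pt) (hdisj : Disjoint R B) (hcard : R.card = B.card)
    (hgp : ∀ a ∈ R ∪ B, ∀ b ∈ R ∪ B, ∀ c ∈ R ∪ B, a ≠ b → a ≠ c → b ≠ c →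
      ¬ Collinear ℝ ({a, b, c} : Set Pt)) :
    ∃ σ : R ≃ B, ∀ a c : R, a ≠ c →
      Disjoint (segment ℝ (a : Pt) (σ a)) (segment ℝ (c : Pt) (σ c)) := by
  classical
  have : Nonempty (R ≃ B) := ⟨Finset.equivOfCardEq hcard⟩
  obtain ⟨σ, hσ⟩ := Finite.exists_min fun σ : R ≃ B => ∑ a : R, euclDist a (σ a)
  refine ⟨σ, fun a c hac => ?_⟩
  rw [Set.disjoint_left]
  intro x hx₁ hx₂
  have hne : ∀ (p : R) (q : B), (p : Pt) ≠ q := fun p q h =>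
    Finset.disjoint_left.1 hdisj p.2 (h ▸ q.2)
  have hR : ∀ p : R, (p : Pt) ∈ R ∪ B := fun p => Finset.mem_union_left _ p.2
  have hB : ∀ q : B, (q : Pt) ∈ R ∪ B := fun q => Finset.mem_union_right _ q.2
  have hac' : (a : Pt) ≠ c := fun h => hac (Subtype.ext h)
  have hσac : (σ a : Pt) ≠ σ c := fun h => hac (σ.injective (Subtype.ext h))
  have hlt := euclDist_swap_lt (mem_segment_iff_wbtw.1 hx₁) (mem_segment_iff_wbtw.1 hx₂)
    (hgp _ (hR a) _ (hB _) _ (hB _) (hne _ _) (hne _ _) hσac)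
    (hgp _ (hR c) _ (hB _) _ (hR a) (hne _ _) hac'.symm (hne _ _).symm)
  have hmin := hσ ((Equiv.swap a c).trans σ)
  have hsplit : ∀ g : R → ℝ,
      ∑ p, g p = g a + (g c + ∑ p ∈ (Finset.univ.erase a).erase c, g p) := fun g => by
    rw [Finset.add_sum_erase _ _ (by simp [hac.symm]), Finset.add_sum_erase _ _ (by simp)]
  rw [hsplit, hsplit] at hmin
  have hrest : ∑ p ∈ (Finset.univ.erase a).erase c, euclDist p (((Equiv.swap a c).trans σ) p) =
      ∑ p ∈ (Finset.univ.erase a).erase c, euclDist p (σ p) := by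
    refine Finset.sum_congr rfl fun p hp => ?_
    simp only [Finset.mem_erase] at hp
    rw [Equiv.trans_apply, Equiv.swap_apply_of_ne_of_ne hp.2.1 hp.1]
  rw [hrest] at hmin
  simp only [Equiv.trans_apply, Equiv.swap_apply_left, Equiv.swap_apply_right] at hmin
  linarith

/-- from `2n` points in general position one may remove any set of at most
`n - 1` edges and still find a non-crossing perfect matching avoiding them. -/
theorem matching_avoiding_n_sub_one_edges (n : ℕ) (X : Finset Pt)
    (hXcard : X.card = 2 * n) (hgp : GenPos X)
    (S : Finset (Sym2 Pt)) (hS : ∀ e ∈ S, IsEdgeOf X e)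
    (hScard : (S.card : ℤ) ≤ (n : ℤ) - 1) :
    ∃ M : Finset (Sym2 Pt), IsNCMatching X M ∧ Avoids M S := by
  classical
  obtain ⟨f, hfS, hfcard⟩ := exists_labelling X S
  obtain ⟨T, hT⟩ := exists_balanced_labels n (by omega) X hXcard f (by omega)
  set R := X.filter fun p => f p ∈ T with hRdef
  set B := X.filter fun p => ¬ f p ∈ T with hBdef
  have hRB : R ∪ B = X := Finset.filter_union_filter_not_eq _ _
  have hdisj : Disjoint R B := Finset.disjoint_filter_filter_not _ _ _
  have hBcard : B.card = n := by
    have := Finset.card_union_of_disjoint hdisj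
    rw [hRB] at this
    omega
  obtain ⟨σ, hσ⟩ := exists_noncrossing_equiv R B hdisj (hT.trans hBcard.symm) (hRB.symm ▸ hgp)
  have hRX : ∀ a : R, (a : Pt) ∈ X := fun a => (Finset.mem_filter.1 a.2).1
  have hBX : ∀ b : B, (b : Pt) ∈ X := fun b => (Finset.mem_filter.1 b.2).1
  have hne : ∀ (p : R) (q : B), (p : Pt) ≠ q := fun p q h =>
    Finset.disjoint_left.1 hdisj p.2 (h ▸ q.2)
  refine ⟨Finset.univ.image fun a : R => s((a : Pt), (σ a : Pt)), ⟨?_, ?_, ?_⟩, ?_⟩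
  · simp only [Finset.mem_image, Finset.mem_univ, true_and]
    rintro _ ⟨a, rfl⟩
    refine ⟨fun h => hne a (σ a) (Sym2.mk_isDiag_iff.1 h), fun p hp => ?_⟩
    rcases Sym2.mem_iff.1 hp with rfl | rfl
    · exact hRX a
    · exact hBX _
  · intro p hp
    simp only [Finset.mem_image, Finset.mem_univ, true_and]
    rw [← hRB, Finset.mem_union] at hp
    rcases hp with hp | hp
    · refine ⟨_, ⟨⟨⟨p, hp⟩, rfl⟩, Sym2.mem_mk_left _ _⟩, ?_⟩
      rintro _ ⟨⟨a, rfl⟩, ha⟩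
      rcases Sym2.mem_iff.1 ha with rfl | h
      · rfl
      · exact absurd h (hne ⟨p, hp⟩ (σ a))
    · obtain ⟨a, ha⟩ := σ.surjective ⟨p, hp⟩
      have hap : (σ a : Pt) = p := congrArg Subtype.val ha
      refine ⟨_, ⟨⟨a, rfl⟩, hap ▸ Sym2.mem_mk_right _ _⟩, ?_⟩
      rintro _ ⟨⟨c, rfl⟩, hc⟩
      rcases Sym2.mem_iff.1 hc with h | h
      · exact absurd h.symm (hne c ⟨p, hp⟩)
      · rw [σ.injective (Subtype.ext (h.symm.trans hap.symm))]
  · intro e he e' he' hee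
    simp only [Finset.coe_image, Finset.coe_univ, Set.image_univ, Set.mem_range] at he he'
    obtain ⟨a, rfl⟩ := he
    obtain ⟨c, rfl⟩ := he'
    exact hσ a c fun h => hee (by rw [h])
  · simp only [Avoids, Finset.mem_image, Finset.mem_univ, true_and]
    rintro _ ⟨a, rfl⟩ hmem
    exact (Finset.mem_filter.1 (σ a).2).2 (hfS _ _ hmem ▸ (Finset.mem_filter.1 a.2).2)
end
end

section
/- Let X be a set of 2n points in general position in the plane and let H be a set of exactly n edges of X such that no non-crossing perfect matching of X avoids H. Call a point of X red if it is an endpoint of some edge of H and blue otherwise. Then for every edge {u,v} ∈ H, on each of the two open half-planes determined by the line through u and v, the number of red points of X equals the number of blue points of X. -/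
open MeasureTheory Set Filter

noncomputable section

/-- The signed cross product determining on which side of the oriented line through `u` and `v`
the point `w` lies (`0 <` : left open half-plane, `< 0` : right open half-plane). -/
def cross (u v w : Pt) : ℝ :=
  (v.1 - u.1) * (w.2 - u.2) - (v.2 - u.2) * (w.1 - u.1)

/-- A point is red (w.r.t. `H`) if it is an endpoint of some edge of `H`. -/
def RedPt (H : Finset (Sym2 Pt)) (p : Pt) : Prop := ∃ e ∈ H, p ∈ e

section SubsetSums

variable {ι : Type*}

lemma sum_eq_of_dvd {I J : Finset ι} {w : ι → ℕ} {n : ℕ} (hw : ∀ i ∈ I, 0 < w i)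
    (hs : ∑ i ∈ I, w i = 2 * n) (hJ : J ⊆ I) (hne : J.Nonempty) (hJI : J ≠ I)
    (hd : n ∣ ∑ i ∈ J, w i) : ∑ i ∈ J, w i = n := by
  have h1 : 0 < ∑ i ∈ J, w i := Finset.sum_pos (fun i hi => hw i (hJ hi)) hne
  have h2 : ∑ i ∈ J, w i < ∑ i ∈ I, w i := by
    obtain ⟨i, hi, hiJ⟩ := Finset.exists_of_ssubset (hJ.ssubset_of_ne hJI)
    exact Finset.sum_lt_sum_of_subset hJ hi hiJ (hw i hi) fun _ _ _ => Nat.zero_le _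
  obtain ⟨k, hk⟩ := hd
  rw [hs] at h2
  have : k = 1 := by
    have : 0 < k := by
      rcases Nat.eq_zero_or_pos k with rfl | h
      · simp_all
      · exact h
    have : k < 2 := by
      by_contra! h
      have := Nat.mul_le_mul_left n h
      omega
    omega
  rw [hk, this, mul_one]

variable [DecidableEq ι]

lemma dvd_sum_sdiff {S T : Finset ι} {w : ι → ℕ} {n : ℕ} (h : S ⊆ T)
    (hm : (∑ i ∈ S, w i) % n = (∑ i ∈ T, w i) % n) : n ∣ ∑ i ∈ T \ S, w i := by
  have := Finset.sum_sdiff (f := w) h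
  have h' : (∑ i ∈ S, w i) ≡ (∑ i ∈ T, w i) [MOD n] := hm
  rw [Nat.modEq_iff_dvd' (by omega)] at h'
  rwa [show (∑ i ∈ T, w i) - ∑ i ∈ S, w i = ∑ i ∈ T \ S, w i by omega] at h'

lemma exists_monotone_chain (K : Finset ι) :
    ∃ C : ℕ → Finset ι, (∀ l ≤ K.card, (C l).card = l) ∧ (∀ l, C l ⊆ K) ∧ Monotone C := by
  induction K using Finset.induction_on with
  | empty => exact ⟨fun _ => ∅, by simp, by simp, fun _ _ _ => le_rfl⟩
  | insert a K ha ih =>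
    obtain ⟨C, h1, h2, h3⟩ := ih
    refine ⟨fun l => if l ≤ K.card then C l else insert a K, ?_, ?_, ?_⟩
    · intro l hl
      rw [Finset.card_insert_of_notMem ha] at hl
      dsimp only
      split_ifs with h
      · exact h1 l h
      · rw [Finset.card_insert_of_notMem ha]; omega
    · intro l
      dsimp only
      split_ifs
      · exact (h2 l).trans (Finset.subset_insert _ _)
      · exact subset_rfl
    · intro l m hlm
      dsimp only
      split_ifs with h h'
      · exact h3 hlm
      · exact (h2 l).trans (Finset.subset_insert _ _)
      · omega
      · exact le_rfl

/-- More than `n` positive integers with sum `2 * n` have a subfamily with sum `n`. -/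
lemma exists_subset_sum_eq_half {I : Finset ι} {w : ι → ℕ} {n : ℕ} (hn : 0 < n)
    (hw : ∀ i ∈ I, 0 < w i) (hs : ∑ i ∈ I, w i = 2 * n) (hI : n < I.card) :
    ∃ J ⊆ I, ∑ i ∈ J, w i = n := by
  obtain ⟨C, h1, h2, h3⟩ := exists_monotone_chain I
  obtain ⟨a, ha, b, hb, hab, he⟩ := Finset.exists_ne_map_eq_of_card_lt_of_maps_to
    (s := Finset.range (n + 1)) (t := Finset.range n) (f := fun l => (∑ i ∈ C l, w i) % n)
    (by simp) (fun l _ => by simpa using Nat.mod_lt _ hn)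
  wlog hlt : a < b generalizing a b
  · exact this b hb a ha hab.symm he.symm (by omega)
  simp only [Finset.mem_range] at ha hb
  have hsub : C b \ C a ⊆ I := Finset.sdiff_subset.trans (h2 b)
  have hcard : (C b \ C a).card = b - a := by
    rw [Finset.card_sdiff_of_subset (h3 hlt.le), h1 b (by omega), h1 a (by omega)]
  refine ⟨C b \ C a, hsub, sum_eq_of_dvd hw hs hsub ?_ ?_ (dvd_sum_sdiff (h3 hlt.le) he)⟩
  · rw [← Finset.card_pos]; omega
  · intro h; rw [h] at hcard; omega

lemma modEq_or_exists_subset_sum {I : Finset ι} {w : ι → ℕ} {n : ℕ} (hn : 0 < n)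
    (hw : ∀ i ∈ I, 0 < w i) (hs : ∑ i ∈ I, w i = 2 * n) (hI : I.card = n) {i j : ι}
    (hi : i ∈ I) (hj : j ∈ I) (hij : i ≠ j) :
    w i ≡ w j [MOD n] ∨ ∃ J ⊆ I, ∑ i ∈ J, w i = n := by
  obtain ⟨C, h1, h2, h3⟩ := exists_monotone_chain ((I.erase i).erase j)
  have hK : ((I.erase i).erase j).card + 2 = n := by
    have h := Finset.card_erase_add_one (Finset.mem_erase.2 ⟨hij.symm, hj⟩)
    have h' := Finset.card_erase_add_one hi
    omega
  have hCi : ∀ l, i ∉ C l := fun l h => by simpa using h2 l h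
  have hCj : ∀ l, j ∉ C l := fun l h => by simpa using h2 l h
  have hCI : ∀ l, C l ⊆ I := fun l =>
    (h2 l).trans ((Finset.erase_subset _ _).trans (Finset.erase_subset _ _))
  have key : ∀ S T : Finset ι, S ⊆ T → T ⊆ I → S.Nonempty → S ≠ T →
      (∑ i ∈ S, w i) % n = (∑ i ∈ T, w i) % n → ∃ J ⊆ I, ∑ i ∈ J, w i = n := by
    intro S T hST hTI hS hne hm
    have hsub : T \ S ⊆ I := Finset.sdiff_subset.trans hTI
    refine ⟨T \ S, hsub, sum_eq_of_dvd hw hs hsub ?_ ?_ (dvd_sum_sdiff hST hm)⟩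
    · rw [Finset.sdiff_nonempty]
      exact fun h => hne (hST.antisymm h)
    · intro h
      obtain ⟨x, hx⟩ := hS
      have := hTI (hST hx)
      rw [← h] at this
      exact (Finset.mem_sdiff.1 this).2 hx
  let f : ℕ → Finset ι := fun l =>
    if l = 0 then {i} else if l = 1 then {j} else insert i (insert j (C (l - 2)))
  obtain ⟨a, ha, b, hb, hab, he⟩ := Finset.exists_ne_map_eq_of_card_lt_of_maps_to
    (s := Finset.range (n + 1)) (t := Finset.range n) (f := fun l => (∑ i ∈ f l, w i) % n)
    (by simp) (fun l _ => by simpa using Nat.mod_lt _ hn)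
  wlog hlt : a < b generalizing a b
  · exact this b hb a ha hab.symm he.symm (by omega)
  simp only [Finset.mem_range] at ha hb
  have hfI : ∀ l, f (l + 2) ⊆ I := by
    intro l x hx
    simp only [f] at hx
    simp only [Nat.add_eq_zero_iff, OfNat.ofNat_ne_zero, and_false, if_false] at hx
    grind
  have hfc : ∀ l, l + 2 ≤ n → (f (l + 2)).card = l + 2 := by
    intro l hl
    have := h1 l (by omega)
    simp only [f]
    rw [if_neg (by omega), if_neg (by omega), Finset.card_insert_of_notMem,
      Finset.card_insert_of_notMem]
    · simp [this]
    · simp [hCj]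
    · simp [hCi, hij]
  obtain rfl | rfl | ⟨a, rfl⟩ : a = 0 ∨ a = 1 ∨ ∃ a', a = a' + 2 := by
    rcases a with _ | _ | a
    · simp
    · simp
    · right; right; exact ⟨a, rfl⟩
  · obtain rfl | ⟨b, rfl⟩ : b = 1 ∨ ∃ b', b = b' + 2 := by
      rcases b with _ | _ | b
      · omega
      · simp
      · right; exact ⟨b, rfl⟩
    · left; simpa [f, Nat.ModEq] using he
    · right
      refine key (f 0) (f (b + 2)) (by simp [f]) (hfI b) (by simp [f]) ?_ he
      intro h
      have := hfc b (by omega)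
      rw [← h] at this
      simp [f] at this
  · obtain ⟨b, rfl⟩ : ∃ b', b = b' + 2 := ⟨b - 2, by omega⟩
    right
    refine key (f 1) (f (b + 2)) (by simp [f]) (hfI b) (by simp [f]) ?_ he
    intro h
    have := hfc b (by omega)
    rw [← h] at this
    simp [f] at this
  · obtain ⟨b, rfl⟩ : ∃ b', b = b' + 2 := ⟨b - 2, by omega⟩
    right
    refine key (f (a + 2)) (f (b + 2)) ?_ (hfI b) (by simp [f]) ?_ he
    · simp only [f, Nat.add_eq_zero_iff, OfNat.ofNat_ne_zero, and_false, if_false,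
        Nat.add_sub_cancel]
      rw [if_neg (by omega), if_neg (by omega)]
      exact Finset.insert_subset_insert _ (Finset.insert_subset_insert _ (h3 (by omega)))
    · intro h
      have h1 := hfc a (by omega)
      have h2 := hfc b (by omega)
      rw [h] at h1
      omega

/-- Positive integers with sum `2 * n`, at least `n` of them, have a subfamily with sum `n`,
unless they are all `2` or they are `n + 1, 1, …, 1`. -/
lemma exists_subset_sum_eq_half_or {I : Finset ι} {w : ι → ℕ} {n : ℕ} (hn : 0 < n)
    (hw : ∀ i ∈ I, 0 < w i) (hs : ∑ i ∈ I, w i = 2 * n) (hI : n ≤ I.card) :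
    (∃ J ⊆ I, ∑ i ∈ J, w i = n) ∨ (∀ i ∈ I, w i = 2) ∨
      ∃ i₀ ∈ I, w i₀ = n + 1 ∧ ∀ i ∈ I, i ≠ i₀ → w i = 1 := by
  by_cases hJ : ∃ J ⊆ I, ∑ i ∈ J, w i = n
  · exact Or.inl hJ
  right
  have hcard : I.card = n := by
    by_contra h
    exact hJ (exists_subset_sum_eq_half hn hw hs (by omega))
  by_cases h2 : ∀ i ∈ I, w i = 2
  · exact Or.inl h2
  right
  have hs2 : ∑ i ∈ I, w i = ∑ i ∈ I, 2 := by simp [hs, hcard, mul_comm]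
  obtain ⟨i₀, hi₀, h3⟩ : ∃ i ∈ I, 2 < w i := by
    by_contra! h
    exact h2 ((Finset.sum_eq_sum_iff_of_le h).1 hs2)
  obtain ⟨i₁, hi₁, h1⟩ : ∃ i ∈ I, w i < 2 := by
    by_contra! h
    exact h2 fun i hi => ((Finset.sum_eq_sum_iff_of_le h).1 hs2.symm i hi).symm
  have hne : i₁ ≠ i₀ := by rintro rfl; omega
  have hmod := (modEq_or_exists_subset_sum hn hw hs hcard hi₁ hi₀ hne).resolve_right hJ
  rw [Nat.modEq_iff_dvd' (by omega)] at hmod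
  have hle := Nat.le_of_dvd (by omega) hmod
  have hpos := hw i₁ hi₁
  have hsplit := Finset.add_sum_erase I w hi₀
  have hc := Finset.card_erase_add_one hi₀
  have hrest : ∀ i ∈ I.erase i₀, 1 ≤ w i := fun i hi => hw i (Finset.mem_of_mem_erase hi)
  have hsum : (I.erase i₀).card ≤ ∑ i ∈ I.erase i₀, w i := by
    simpa using Finset.sum_le_sum hrest
  refine ⟨i₀, hi₀, by omega, fun i hi hii => ?_⟩
  refine ((Finset.sum_eq_sum_iff_of_le hrest).1 ?_ i (Finset.mem_erase.2 ⟨hii, hi⟩)).symm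
  simp only [Finset.sum_const, smul_eq_mul, mul_one]
  omega

end SubsetSums

section Labelings

variable {α β : Type*} [DecidableEq β]

lemma card_preimage_of_labels (V : Finset α) (c : α → β) (J : Finset β) :
    (V.filter fun p => c p ∈ J).card = ∑ i ∈ J, (V.filter fun p => c p = i).card := by
  rw [Finset.card_eq_sum_card_fiberwise (f := c) (t := J) (by intro x; simp)]
  refine Finset.sum_congr rfl fun i hi => ?_
  congr 1
  ext p
  simp only [Finset.mem_filter]
  grind

lemma card_image_le_merge (V : Finset α) (c : α → β) (i j : β) :
    (V.image c).card ≤ (V.image fun x => if c x = i then j else c x).card + 1 := by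
  refine (Finset.card_le_card (t := insert i (V.image fun x => if c x = i then j else c x))
    ?_).trans (Finset.card_insert_le _ _)
  intro k hk
  obtain ⟨p, hp, rfl⟩ := Finset.mem_image.1 hk
  by_cases h : c p = i
  · simp [h]
  · exact Finset.mem_insert_of_mem (Finset.mem_image.2 ⟨p, hp, by simp [h]⟩)

variable [DecidableEq α]

/-- If a labeling of `2 * m` points uses more than `m` labels, then some union of label classes
contains exactly half of the points. -/
lemma exists_half_of_many_labels {V : Finset α} {m : ℕ} (hm : 0 < m) (hV : V.card = 2 * m)
    (c : α → β) (hc : m < (V.image c).card) :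
    ∃ A ⊆ V, A.card = m ∧ ∀ p ∈ A, ∀ q ∈ V \ A, c p ≠ c q := by
  obtain ⟨J, -, hs⟩ := exists_subset_sum_eq_half (I := V.image c)
    (w := fun i => (V.filter fun p => c p = i).card) hm
    (fun i hi => by
      obtain ⟨p, hp, rfl⟩ := Finset.mem_image.1 hi
      exact Finset.card_pos.2 ⟨p, by simp [hp]⟩)
    (by rw [← hV]; exact (Finset.card_eq_sum_card_image c V).symm) hc
  refine ⟨V.filter fun p => c p ∈ J, Finset.filter_subset _ _, ?_, ?_⟩
  · rw [card_preimage_of_labels V c J, hs]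
  · intro p hp q hq
    simp only [Finset.mem_filter, Finset.mem_sdiff] at hp hq
    grind

lemma exists_half_or_of_labels {V : Finset α} {m : ℕ} (hm : 0 < m) (hV : V.card = 2 * m)
    (c : α → β) (hc : m ≤ (V.image c).card) :
    (∃ A ⊆ V, A.card = m ∧ ∀ p ∈ A, ∀ q ∈ V \ A, c p ≠ c q) ∨
    (∀ p ∈ V, (V.filter fun q => c q = c p).card = 2) ∨
    (∃ p₀ ∈ V, (V.filter fun q => c q = c p₀).card = m + 1 ∧
      ∀ p ∈ V, c p ≠ c p₀ → (V.filter fun q => c q = c p).card = 1) := by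
  rcases exists_subset_sum_eq_half_or (I := V.image c)
    (w := fun i => (V.filter fun p => c p = i).card) hm
    (fun i hi => by
      obtain ⟨p, hp, rfl⟩ := Finset.mem_image.1 hi
      exact Finset.card_pos.2 ⟨p, by simp [hp]⟩)
    (by rw [← hV]; exact (Finset.card_eq_sum_card_image c V).symm) hc with
    ⟨J, -, hs⟩ | h | ⟨i₀, hi₀, h1, h2⟩
  · left
    refine ⟨V.filter fun p => c p ∈ J, Finset.filter_subset _ _, ?_, ?_⟩
    · rw [card_preimage_of_labels V c J, hs]
    · intro p hp q hq
      simp only [Finset.mem_filter, Finset.mem_sdiff] at hp hq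
      grind
  · exact Or.inr (Or.inl fun p hp => h _ (Finset.mem_image_of_mem c hp))
  · obtain ⟨p₀, hp₀, rfl⟩ := Finset.mem_image.1 hi₀
    exact Or.inr (Or.inr ⟨p₀, hp₀, h1, fun p hp hne => h2 _ (Finset.mem_image_of_mem c hp) hne⟩)

/-- The vertex set of a graph with edge set `E` has a labeling, constant along the edges, with
at least `|V| - |E|` labels. -/
lemma exists_labeling (V : Finset α) (E : Finset (Sym2 α)) :
    ∃ c : α → α, (∀ p q, s(p, q) ∈ E → c p = c q) ∧ V.card ≤ (V.image c).card + E.card := by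
  induction E using Finset.induction_on with
  | empty => exact ⟨id, by simp, by simp⟩
  | insert e E he ih =>
    obtain ⟨c, h1, h2⟩ := ih
    induction e using Sym2.ind with
    | _ u v =>
      refine ⟨fun x => if c x = c u then c v else c x, ?_, ?_⟩
      · intro p q hpq
        rcases Finset.mem_insert.1 hpq with h | h
        · rcases Sym2.eq_iff.1 h with ⟨rfl, rfl⟩ | ⟨rfl, rfl⟩
          · simp
          · simp
        · simp only [h1 p q h]
      · rw [Finset.card_insert_of_notMem he]
        have := card_image_le_merge V c (c u) (c v)
        omega

end Labelings

section Geometry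

lemma GenPos.mono {X Y : Finset Pt} (h : GenPos X) (hYX : Y ⊆ X) : GenPos Y :=
  fun a ha b hb c hc => h a (hYX ha) b (hYX hb) c (hYX hc)

lemma collinear_of_cross_eq_zero {a b c : Pt} (hab : a ≠ b) (h : cross a b c = 0) :
    Collinear ℝ ({a, b, c} : Set Pt) := by
  rw [collinear_iff_of_mem (p₀ := a) (by simp)]
  refine ⟨b - a, ?_⟩
  have key : ∃ r : ℝ, c = r • (b - a) +ᵥ a := by
    unfold cross at h
    by_cases h1 : b.1 - a.1 = 0
    · have h2 : b.2 - a.2 ≠ 0 := by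
        intro h2
        exact hab (Prod.ext (by linarith) (by linarith))
      refine ⟨(c.2 - a.2) / (b.2 - a.2), Prod.ext ?_ ?_⟩
      · have h3 : (b.2 - a.2) * (c.1 - a.1) = 0 := by rw [h1] at h; linarith
        have h4 := (mul_eq_zero.1 h3).resolve_left h2
        simp [h1]
        linarith
      · simp
        field_simp
        ring
    · refine ⟨(c.1 - a.1) / (b.1 - a.1), Prod.ext ?_ ?_⟩
      · simp
        field_simp
        ring
      · simp
        field_simp
        linarith
  intro p hp
  simp only [Set.mem_insert_iff, Set.mem_singleton_iff] at hp
  rcases hp with rfl | rfl | rfl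
  · exact ⟨0, by simp⟩
  · exact ⟨1, by simp⟩
  · exact key

lemma GenPos.cross_ne_zero {X : Finset Pt} (h : GenPos X) {a b c : Pt} (ha : a ∈ X) (hb : b ∈ X)
    (hc : c ∈ X) (hab : a ≠ b) (hac : a ≠ c) (hbc : b ≠ c) : cross a b c ≠ 0 :=
  fun h0 => h a ha b hb c hc hab hac hbc (collinear_of_cross_eq_zero hab h0)

/-- The Euclidean distance in the plane. -/
def eDist (p q : Pt) : ℝ := dist (Complex.equivRealProd.symm p) (Complex.equivRealProd.symm q)

lemma exists_smul_of_mem_segment {a b p : Pt} (h : p ∈ segment ℝ a b) :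
    ∃ t : ℝ, p.1 = a.1 + t * (b.1 - a.1) ∧ p.2 = a.2 + t * (b.2 - a.2) := by
  rw [segment_eq_image'] at h
  obtain ⟨t, -, rfl⟩ := h
  exact ⟨t, by simp, by simp⟩

lemma eDist_add_eDist_of_mem_segment {a b p : Pt} (h : p ∈ segment ℝ a b) :
    eDist a p + eDist p b = eDist a b := by
  have h' : Wbtw ℝ (Complex.equivRealProd.symm a) (Complex.equivRealProd.symm p)
      (Complex.equivRealProd.symm b) := by
    rw [segment_eq_image'] at h
    obtain ⟨t, ht, rfl⟩ := h
    refine ⟨t, ht, ?_⟩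
    apply Complex.ext
    · simp [AffineMap.lineMap_apply]; ring
    · simp [AffineMap.lineMap_apply]; ring
  exact h'.dist_add_dist

lemma exists_smul_of_eDist_add_eq {a b p : Pt} (h : eDist a p + eDist p b = eDist a b) :
    ∃ t : ℝ, p.1 = a.1 + t * (b.1 - a.1) ∧ p.2 = a.2 + t * (b.2 - a.2) := by
  obtain ⟨t, -, ht⟩ := dist_add_dist_eq_iff.1 h
  have h1 := congrArg Complex.re ht
  have h2 := congrArg Complex.im ht
  simp [AffineMap.lineMap_apply] at h1 h2
  exact ⟨t, by linarith, by linarith⟩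

lemma eDist_uncross {a b c d p : Pt} (habd : cross a b d ≠ 0) (hcda : cross c d a ≠ 0)
    (h1 : p ∈ segment ℝ a b) (h2 : p ∈ segment ℝ c d) :
    eDist a d + eDist c b < eDist a b + eDist c d := by
  have e1 := eDist_add_eDist_of_mem_segment h1
  have e2 := eDist_add_eDist_of_mem_segment h2
  have t1 : eDist a d ≤ eDist a p + eDist p d := dist_triangle _ _ _
  have t2 : eDist c b ≤ eDist c p + eDist p b := dist_triangle _ _ _
  refine lt_of_le_of_ne (by linarith) fun heq => ?_
  obtain ⟨t, ht1, ht2⟩ := exists_smul_of_eDist_add_eq (a := a) (b := d) (p := p) (by linarith)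
  obtain ⟨s, hs1, hs2⟩ := exists_smul_of_mem_segment h1
  obtain ⟨r, hr1, hr2⟩ := exists_smul_of_mem_segment h2
  have hs : s = 0 := by
    have : s * cross a b d = 0 := by
      unfold cross
      have e1 : s * (b.1 - a.1) = t * (d.1 - a.1) := by linarith
      have e2 : s * (b.2 - a.2) = t * (d.2 - a.2) := by linarith
      linear_combination (d.2 - a.2) * e1 - (d.1 - a.1) * e2
    exact (mul_eq_zero.1 this).resolve_right habd
  subst hs
  apply hcda
  have e1 : a.1 = c.1 + r * (d.1 - c.1) := by linarith
  have e2 : a.2 = c.2 + r * (d.2 - c.2) := by linarith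
  unfold cross
  rw [e1, e2]
  ring

/-- Two disjoint point sets of equal size, in general position together, have a non-crossing
perfect matching all of whose edges join the two sets. -/
lemma exists_bichromatic_matching {A B : Finset Pt} (hd : Disjoint A B) (hc : A.card = B.card)
    (hg : GenPos (A ∪ B)) :
    ∃ M, IsNCMatching (A ∪ B) M ∧ ∀ e ∈ M, ∃ a ∈ A, ∃ b ∈ B, e = s(a, b) := by
  classical
  have hne : ∀ a ∈ A, ∀ b ∈ B, a ≠ b := by
    rintro a ha b hb rfl
    exact Finset.disjoint_left.1 hd ha hb
  have : Nonempty (A ≃ B) := ⟨Finset.equivOfCardEq hc⟩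
  obtain ⟨σ, hσ⟩ := Finite.exists_min fun σ : A ≃ B => ∑ a : A, eDist a (σ a)
  have hdis : ∀ a b : A, a ≠ b →
      Disjoint (segment ℝ (a : Pt) (σ a)) (segment ℝ (b : Pt) (σ b)) := by
    intro a b hab
    rw [Set.disjoint_left]
    intro p hp1 hp2
    have ha := Finset.mem_union_left B a.2
    have hb := Finset.mem_union_left B b.2
    have hsa := Finset.mem_union_right A (σ a).2
    have hsb := Finset.mem_union_right A (σ b).2
    have hab' : (a : Pt) ≠ b := fun h => hab (Subtype.ext h)
    have hσab : (σ a : Pt) ≠ σ b := fun h => hab (σ.injective (Subtype.ext h))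
    have hlt := eDist_uncross
      (hg.cross_ne_zero ha hsa hsb (hne _ a.2 _ (σ a).2) (hne _ a.2 _ (σ b).2) hσab)
      (hg.cross_ne_zero hb hsb ha (hne _ b.2 _ (σ b).2) hab'.symm (hne _ a.2 _ (σ b).2).symm)
      hp1 hp2
    have hle := hσ ((Equiv.swap a b).trans σ)
    have hb' : b ∈ Finset.univ.erase a := by simp [hab.symm]
    rw [← Finset.add_sum_erase _ _ (Finset.mem_univ a),
      ← Finset.add_sum_erase _ (fun x : A => eDist x (((Equiv.swap a b).trans σ) x))
        (Finset.mem_univ a),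
      ← Finset.add_sum_erase _ _ hb',
      ← Finset.add_sum_erase _ (fun x : A => eDist x (((Equiv.swap a b).trans σ) x)) hb'] at hle
    have hrest : ∑ x ∈ (Finset.univ.erase a).erase b, eDist x (((Equiv.swap a b).trans σ) x) =
        ∑ x ∈ (Finset.univ.erase a).erase b, eDist x (σ x) := by
      refine Finset.sum_congr rfl fun x hx => ?_
      simp only [Finset.mem_erase] at hx
      simp [Equiv.swap_apply_of_ne_of_ne hx.2.1 hx.1]
    rw [hrest] at hle
    simp only [Equiv.trans_apply, Equiv.swap_apply_left, Equiv.swap_apply_right] at hle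
    linarith
  refine ⟨Finset.univ.image fun a : A => s((a : Pt), (σ a : Pt)), ⟨?_, ?_, ?_⟩, ?_⟩
  · intro e he
    obtain ⟨a, -, rfl⟩ := Finset.mem_image.1 he
    refine ⟨by simpa using hne _ a.2 _ (σ a).2, ?_⟩
    intro p hp
    rcases Sym2.mem_iff.1 hp with rfl | rfl
    · exact Finset.mem_union_left B a.2
    · exact Finset.mem_union_right A (σ a).2
  · have huniq : ∀ (a : A) (p : Pt), (p = a ∨ p = σ a) → ∀ e, e ∈ (Finset.univ.image
        fun a : A => s((a : Pt), (σ a : Pt))) ∧ p ∈ e → e = s((a : Pt), (σ a : Pt)) := by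
      rintro a p hp e ⟨he, hpe⟩
      obtain ⟨b, -, rfl⟩ := Finset.mem_image.1 he
      suffices b = a by rw [this]
      by_contra hba
      refine Set.disjoint_left.1 (hdis b a hba) (show p ∈ _ from ?_) ?_
      · rcases Sym2.mem_iff.1 hpe with rfl | rfl
        · exact left_mem_segment _ _ _
        · exact right_mem_segment _ _ _
      · rcases hp with rfl | rfl
        · exact left_mem_segment _ _ _
        · exact right_mem_segment _ _ _
    intro p hp
    rcases Finset.mem_union.1 hp with h | h
    · exact ⟨s(p, (σ ⟨p, h⟩ : Pt)), ⟨Finset.mem_image.2 ⟨⟨p, h⟩, by simp, rfl⟩, by simp⟩,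
        huniq ⟨p, h⟩ p (Or.inl rfl)⟩
    · have hs : (σ (σ.symm ⟨p, h⟩) : Pt) = p := by simp
      exact ⟨s((σ.symm ⟨p, h⟩ : Pt), (σ (σ.symm ⟨p, h⟩) : Pt)),
        ⟨Finset.mem_image.2 ⟨σ.symm ⟨p, h⟩, by simp, rfl⟩, by simp⟩,
        huniq (σ.symm ⟨p, h⟩) p (Or.inr hs.symm)⟩
  · intro e he f hf hef
    obtain ⟨a, -, rfl⟩ := Finset.mem_image.1 he
    obtain ⟨b, -, rfl⟩ := Finset.mem_image.1 hf
    exact hdis a b fun h => hef (by rw [h])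
  · intro e he
    obtain ⟨a, -, rfl⟩ := Finset.mem_image.1 he
    exact ⟨a, a.2, σ a, (σ a).2, rfl⟩

/-- `X` has a non-crossing perfect matching avoiding `H`. -/
def HasAvoidingMatching (X : Finset Pt) (H : Finset (Sym2 Pt)) : Prop :=
  ∃ M, IsNCMatching X M ∧ Avoids M H

lemma hasAvoidingMatching_of_bipartition {A B : Finset Pt} {H : Finset (Sym2 Pt)}
    (hd : Disjoint A B) (hc : A.card = B.card) (hg : GenPos (A ∪ B))
    (hAB : ∀ a ∈ A, ∀ b ∈ B, s(a, b) ∉ H) : HasAvoidingMatching (A ∪ B) H := by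
  obtain ⟨M, hM, hMe⟩ := exists_bichromatic_matching hd hc hg
  refine ⟨M, hM, fun e he => ?_⟩
  obtain ⟨a, ha, b, hb, rfl⟩ := hMe e he
  exact hAB a ha b hb

lemma edgeSeg_subset_of_convex {C : Set Pt} (hC : Convex ℝ C) {e : Sym2 Pt}
    (h : ∀ p ∈ e, p ∈ C) : edgeSeg e ⊆ C := by
  induction e using Sym2.ind with
  | _ a b => exact hC.segment_subset (h a (by simp)) (h b (by simp))

lemma HasAvoidingMatching.union {X Y : Finset Pt} {H : Finset (Sym2 Pt)} {a b c : ℝ}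
    (hX : HasAvoidingMatching X H) (hY : HasAvoidingMatching Y H)
    (hXc : ∀ p ∈ X, a * p.1 + b * p.2 ≤ c) (hYc : ∀ p ∈ Y, c < a * p.1 + b * p.2) :
    HasAvoidingMatching (X ∪ Y) H := by
  obtain ⟨M, ⟨hM1, hM2, hM3⟩, hMH⟩ := hX
  obtain ⟨N, ⟨hN1, hN2, hN3⟩, hNH⟩ := hY
  have hlin : IsLinearMap ℝ fun p : Pt => a * p.1 + b * p.2 :=
    ⟨fun p q => by simp; ring, fun r p => by simp; ring⟩
  have hMC : ∀ e ∈ M, edgeSeg e ⊆ {p | a * p.1 + b * p.2 ≤ c} := fun e he =>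
    edgeSeg_subset_of_convex (convex_halfSpace_le hlin c) fun p hp => hXc p ((hM1 e he).2 p hp)
  have hNC : ∀ e ∈ N, edgeSeg e ⊆ {p | c < a * p.1 + b * p.2} := fun e he =>
    edgeSeg_subset_of_convex (convex_halfSpace_gt hlin c) fun p hp => hYc p ((hN1 e he).2 p hp)
  have hMN : ∀ e ∈ M, ∀ f ∈ N, Disjoint (edgeSeg e) (edgeSeg f) := by
    intro e he f hf
    rw [Set.disjoint_left]
    intro p hp hq
    exact absurd (show c < a * p.1 + b * p.2 from hNC f hf hq) (not_lt.2 (hMC e he hp))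
  have hXY : ∀ p ∈ X, p ∉ Y := fun p hp hq => absurd (hYc p hq) (not_lt.2 (hXc p hp))
  refine ⟨M ∪ N, ⟨?_, ?_, ?_⟩, ?_⟩
  · intro e he
    rcases Finset.mem_union.1 he with h | h
    · exact ⟨(hM1 e h).1, fun p hp => Finset.mem_union_left _ ((hM1 e h).2 p hp)⟩
    · exact ⟨(hN1 e h).1, fun p hp => Finset.mem_union_right _ ((hN1 e h).2 p hp)⟩
  · intro p hp
    rcases Finset.mem_union.1 hp with h | h
    · obtain ⟨e, ⟨he, hpe⟩, hu⟩ := hM2 p h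
      refine ⟨e, ⟨Finset.mem_union_left _ he, hpe⟩, ?_⟩
      rintro f ⟨hf, hpf⟩
      rcases Finset.mem_union.1 hf with h' | h'
      · exact hu f ⟨h', hpf⟩
      · exact absurd ((hN1 f h').2 p hpf) (hXY p h)
    · obtain ⟨e, ⟨he, hpe⟩, hu⟩ := hN2 p h
      refine ⟨e, ⟨Finset.mem_union_right _ he, hpe⟩, ?_⟩
      rintro f ⟨hf, hpf⟩
      rcases Finset.mem_union.1 hf with h' | h'
      · exact absurd h (hXY p ((hM1 f h').2 p hpf))
      · exact hu f ⟨h', hpf⟩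
  · intro e he f hf hef
    rcases Finset.mem_union.1 he with h | h <;> rcases Finset.mem_union.1 hf with h' | h'
    · exact hM3 h h' hef
    · exact hMN e h f h'
    · exact (hMN f h' e h).symm
    · exact hN3 h h' hef
  · intro e he
    rcases Finset.mem_union.1 he with h | h
    · exact hMH e h
    · exact hNH e h

/-- A discrete intermediate value theorem for sums with terms of absolute value at most one,
ordered by an injective real key. -/
lemma exists_partial_sum_eq_zero {ι : Type*} (S : Finset ι) (key : ι → ℝ) (e : ι → ℤ)
    (hinj : ∀ p ∈ S, ∀ q ∈ S, key p = key q → p = q) (he : ∀ p ∈ S, e p ≤ 1) {g : ℤ}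
    (hg : g ≤ 0) (hsum : 0 ≤ g + ∑ p ∈ S, e p) {m : ℝ} (hm : ∀ p ∈ S, key p < m) :
    ∃ t < m, (∀ p ∈ S, key p ≠ t) ∧ g + ∑ p ∈ S with key p < t, e p = 0 := by
  classical
  induction S using Finset.induction_on_max_value key generalizing m with
  | empty => exact ⟨m - 1, by linarith, by simp, by simp at hsum ⊢; omega⟩
  | insert a S ha hmax ih =>
    have hlt : ∀ p ∈ S, key p < key a := fun p hp => lt_of_le_of_ne (hmax p hp) fun h =>
      ha (hinj p (by simp [hp]) a (by simp) h ▸ hp)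
    have ham := hm a (by simp)
    rw [Finset.sum_insert ha] at hsum
    have hea := he a (by simp)
    rcases hsum.eq_or_lt with h | h
    · refine ⟨(key a + m) / 2, by linarith, ?_, ?_⟩
      · intro p hp
        rcases Finset.mem_insert.1 hp with rfl | hp
        · intro h; linarith
        · have := hlt p hp
          intro h; linarith
      · rw [Finset.filter_true_of_mem, Finset.sum_insert ha, ← h]
        intro p hp
        rcases Finset.mem_insert.1 hp with rfl | hp
        · linarith
        · have := hlt p hp
          linarith
    · obtain ⟨t, ht, hne, hz⟩ := ih (fun p hp q hq => hinj p (by simp [hp]) q (by simp [hq]))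
        (fun p hp => he p (by simp [hp])) (by omega) hlt
      refine ⟨t, ht.trans ham, ?_, ?_⟩
      · intro p hp
        rcases Finset.mem_insert.1 hp with rfl | hp
        · exact ht.ne'
        · exact hne p hp
      · rwa [Finset.filter_insert, if_neg (by linarith)]

set_option maxHeartbeats 1000000 in
/-- If `s(u, v)` is the only edge of `H` joining the equally large color classes `A` and `B`, and
the left side of the line through `u` and `v` is unbalanced, then some line separates `u` from `v`
and has balanced sides, so `H` can be avoided. -/
lemma hasAvoidingMatching_of_unbalanced {A B : Finset Pt} {H : Finset (Sym2 Pt)}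
    (hd : Disjoint A B) (hc : A.card = B.card) (hg : GenPos (A ∪ B)) {u v : Pt}
    (hu : u ∈ A) (hv : v ∈ B)
    (hAB : ∀ a ∈ A, ∀ b ∈ B, s(a, b) ∈ H → a = u ∧ b = v)
    (hL : (A.filter fun p => 0 < cross u v p).card ≠ (B.filter fun p => 0 < cross u v p).card) :
    HasAvoidingMatching (A ∪ B) H := by
  classical
  have huv : u ≠ v := fun h => Finset.disjoint_left.1 hd hu (h ▸ hv)
  set S := (A.erase u) ∪ (B.erase v) with hS
  have hSX : ∀ p ∈ S, p ∈ A ∪ B ∧ p ≠ u ∧ p ≠ v := by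
    intro p hp
    rcases Finset.mem_union.1 hp with h | h
    · have h' := Finset.mem_erase.1 h
      exact ⟨Finset.mem_union_left _ h'.2, h'.1, fun h => Finset.disjoint_left.1 hd h'.2 (h ▸ hv)⟩
    · have h' := Finset.mem_erase.1 h
      exact ⟨Finset.mem_union_right _ h'.2, fun h => Finset.disjoint_left.1 hd hu (h ▸ h'.2), h'.1⟩
  have huX : u ∈ A ∪ B := Finset.mem_union_left _ hu
  have hvX : v ∈ A ∪ B := Finset.mem_union_right _ hv
  let x : Pt → ℝ := fun p => (v.1 - u.1) * (p.1 - u.1) + (v.2 - u.2) * (p.2 - u.2)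
  let y : Pt → ℝ := fun p => cross u v p
  have hy : ∀ p ∈ S, y p ≠ 0 := fun p hp =>
    hg.cross_ne_zero huX hvX (hSX p hp).1 huv (hSX p hp).2.1.symm (hSX p hp).2.2.symm
  have hxv : 0 < x v := by
    have : v.1 - u.1 ≠ 0 ∨ v.2 - u.2 ≠ 0 := by
      by_contra! h
      exact huv (Prod.ext (by linarith [h.1]) (by linarith [h.2]))
    simp only [x]
    rcases this with h | h
    · have := mul_self_pos.2 h
      nlinarith [mul_self_nonneg (v.2 - u.2)]
    · have := mul_self_pos.2 h
      nlinarith [mul_self_nonneg (v.1 - u.1)]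
  have hyv : y v = 0 := by simp only [y, cross]; ring
  have hxu : x u = 0 := by simp [x]
  have hyu : y u = 0 := by simp [y, cross]
  have hid : ∀ p q, x p * y q - y p * x q = x v * cross u p q := by
    intro p q; simp only [x, y, cross]; ring
  let key : Pt → ℝ := fun p => x p / y p
  have hkey : ∀ p ∈ S, ∀ q ∈ S, key p = key q → p = q := by
    intro p hp q hq h
    by_contra hpq
    refine hg.cross_ne_zero huX (hSX p hp).1 (hSX q hq).1 (hSX p hp).2.1.symm
      (hSX q hq).2.1.symm hpq ?_
    have h' := (div_eq_div_iff (hy p hp) (hy q hq)).1 h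
    have := hid p q
    rw [h', mul_comm (y p), sub_self] at this
    exact (mul_eq_zero.1 this.symm).resolve_left hxv.ne'
  let w : Pt → ℤ := fun p => if p ∈ A then 1 else -1
  have hwS : ∀ P : Pt → Prop, ∑ p ∈ S with P p, w p =
      (((A.erase u).filter P).card : ℤ) - ((B.erase v).filter P).card := by
    intro P
    rw [hS, Finset.filter_union, Finset.sum_union]
    · rw [Finset.sum_congr rfl (g := fun _ => (1 : ℤ)), Finset.sum_congr (s₁ := (B.erase v).filter P)
        rfl (g := fun _ => (-1 : ℤ))]
      · simp; ring
      · intro p hp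
        simp only [Finset.mem_filter, Finset.mem_erase] at hp
        simp [w, Finset.disjoint_right.1 hd hp.1.2]
      · intro p hp
        simp only [Finset.mem_filter, Finset.mem_erase] at hp
        simp [w, hp.1.2]
    · exact Finset.disjoint_filter_filter
        (hd.mono (Finset.erase_subset _ _) (Finset.erase_subset _ _))
  have hfu : ∀ P : Pt → Prop, ¬ P u → (A.erase u).filter P = A.filter P := by
    intro P hP
    ext p
    simp only [Finset.mem_filter, Finset.mem_erase]
    grind
  have hfv : ∀ P : Pt → Prop, ¬ P v → (B.erase v).filter P = B.filter P := by
    intro P hP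
    ext p
    simp only [Finset.mem_filter, Finset.mem_erase]
    grind
  have hfv' : ∀ P : Pt → Prop, P v → ((B.filter P).card : ℤ) = ((B.erase v).filter P).card + 1 := by
    intro P hP
    have h : (B.erase v).filter P = (B.filter P).erase v := by
      ext p
      simp only [Finset.mem_filter, Finset.mem_erase]
      tauto
    rw [h, ← Nat.cast_succ, Nat.succ_eq_add_one,
      Finset.card_erase_add_one (Finset.mem_filter.2 ⟨hv, hP⟩)]
  set d : ℤ := ∑ p ∈ S with 0 < y p, w p with hdef
  have hd0 : d ≠ 0 := by
    rw [hdef, hwS, hfu _ (by simp [hyu]), hfv _ (by simp [hyv])]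
    intro h
    apply hL
    have : ((A.filter fun p => 0 < y p).card : ℤ) = (B.filter fun p => 0 < y p).card := by linarith
    exact_mod_cast this
  have htot : ∑ p ∈ S, w p = 0 := by
    have := hwS fun _ => True
    simp only [Finset.filter_true] at this
    rw [this, Finset.card_erase_of_mem hu, Finset.card_erase_of_mem hv, hc, sub_self]
  let e : Pt → ℤ := fun p => if 0 < y p then - w p else w p
  have hesum : ∑ p ∈ S, e p = - 2 * d := by
    have h1 := Finset.sum_filter_add_sum_filter_not S (fun p => 0 < y p) w
    have h2 := Finset.sum_filter_add_sum_filter_not S (fun p => 0 < y p) e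
    have h3 : ∑ p ∈ S with 0 < y p, e p = - d := by
      rw [hdef, ← Finset.sum_neg_distrib]
      exact Finset.sum_congr rfl fun p hp => by simp [e, (Finset.mem_filter.1 hp).2]
    have h4 : ∑ p ∈ S with ¬ 0 < y p, e p = ∑ p ∈ S with ¬ 0 < y p, w p :=
      Finset.sum_congr rfl fun p hp => if_neg (Finset.mem_filter.1 hp).2
    linarith
  have he1 : ∀ p, e p ≤ 1 ∧ - e p ≤ 1 := by
    intro p
    simp only [e, w]
    split_ifs <;> simp
  obtain ⟨m, hm⟩ : ∃ m, ∀ p ∈ S, key p < m := by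
    obtain ⟨m, hm⟩ := (S.image key).bddAbove
    exact ⟨m + 1, fun p hp => lt_of_le_of_lt (hm (Finset.mem_image_of_mem key hp)) (by simp)⟩
  obtain ⟨t, hne, ht⟩ : ∃ t, (∀ p ∈ S, key p ≠ t) ∧
      (d - 1) + ∑ p ∈ S with key p < t, e p = 0 := by
    rcases lt_or_gt_of_ne hd0 with h | h
    · obtain ⟨t, -, h1, h2⟩ := exists_partial_sum_eq_zero S key e hkey (fun p _ => (he1 p).1)
        (g := d - 1) (by omega) (by rw [hesum]; omega) hm
      exact ⟨t, h1, h2⟩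
    · obtain ⟨t, -, h1, h2⟩ := exists_partial_sum_eq_zero S key (fun p => - e p) hkey
        (fun p _ => (he1 p).2) (g := 1 - d) (by omega)
        (by rw [Finset.sum_neg_distrib, hesum]; omega) hm
      rw [Finset.sum_neg_distrib] at h2
      exact ⟨t, h1, by linarith⟩
  let φ : Pt → Prop := fun p => 0 < x p - t * y p
  have hφS : ∑ p ∈ S with φ p, w p = d + ∑ p ∈ S with key p < t, e p := by
    rw [hdef]
    simp only [Finset.sum_filter]
    rw [← Finset.sum_add_distrib]
    refine Finset.sum_congr rfl fun p hp => ?_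
    have hne' := hne p hp
    rcases lt_or_gt_of_ne (hy p hp) with h | h
    · have : φ p ↔ key p < t := by
        simp only [φ, key]
        rw [div_lt_iff_of_neg h, sub_pos]
      simp [this, e, h.not_gt]
    · have : φ p ↔ ¬ key p < t := by
        simp only [φ]
        rw [sub_pos, ← lt_div_iff₀ h, not_lt]
        exact ⟨le_of_lt, fun h => lt_of_le_of_ne h hne'.symm⟩
      by_cases hk : key p < t <;> simp [this, e, h, hk]
  have hφu : ¬ φ u := by simp [φ, hxu, hyu]
  have hφv : φ v := by simpa [φ, hyv] using hxv
  have hpos : (A.filter φ).card = (B.filter φ).card := by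
    have h1 := hwS φ
    have h2 := hfv' φ hφv
    rw [hfu φ hφu, hφS] at h1
    zify
    linarith
  have hneg : (A.filter fun p => ¬ φ p).card = (B.filter fun p => ¬ φ p).card := by
    have h1 := Finset.card_filter_add_card_filter_not (s := A) φ
    have h2 := Finset.card_filter_add_card_filter_not (s := B) φ
    omega
  have hX : A ∪ B = (A.filter (fun p => ¬ φ p) ∪ B.filter fun p => ¬ φ p) ∪
      (A.filter φ ∪ B.filter φ) := by
    ext p
    simp only [Finset.mem_union, Finset.mem_filter]
    tauto
  have hsub : ∀ (P : Pt → Prop) [DecidablePred P], A.filter P ∪ B.filter P ⊆ A ∪ B := fun P _ =>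
    Finset.union_subset_union (Finset.filter_subset _ _) (Finset.filter_subset _ _)
  have hφ : ∀ p, x p - t * y p = ((v.1 - u.1) + t * (v.2 - u.2)) * p.1 +
      ((v.2 - u.2) - t * (v.1 - u.1)) * p.2 -
      (((v.1 - u.1) + t * (v.2 - u.2)) * u.1 + ((v.2 - u.2) - t * (v.1 - u.1)) * u.2) := by
    intro p
    simp only [x, y, cross]
    ring
  rw [hX]
  refine HasAvoidingMatching.union
    (hasAvoidingMatching_of_bipartition (Finset.disjoint_filter_filter hd) hneg
      (hg.mono (hsub _)) ?_)
    (hasAvoidingMatching_of_bipartition (Finset.disjoint_filter_filter hd) hpos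
      (hg.mono (hsub _)) ?_)
    (a := (v.1 - u.1) + t * (v.2 - u.2)) (b := (v.2 - u.2) - t * (v.1 - u.1))
    (c := ((v.1 - u.1) + t * (v.2 - u.2)) * u.1 + ((v.2 - u.2) - t * (v.1 - u.1)) * u.2) ?_ ?_
  · intro a ha b hb hab
    rw [Finset.mem_filter] at ha hb
    obtain ⟨rfl, rfl⟩ := hAB a ha.1 b hb.1 hab
    exact hb.2 hφv
  · intro a ha b hb hab
    rw [Finset.mem_filter] at ha hb
    obtain ⟨rfl, rfl⟩ := hAB a ha.1 b hb.1 hab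
    exact hφu ha.2
  · intro p hp
    have h : ¬ φ p := by
      rcases Finset.mem_union.1 hp with h | h <;> exact (Finset.mem_filter.1 h).2
    simp only [φ, hφ, not_lt] at h
    linarith
  · intro p hp
    have h : φ p := by
      rcases Finset.mem_union.1 hp with h | h <;> exact (Finset.mem_filter.1 h).2
    simp only [φ, hφ] at h
    linarith

/-- A vertex `u` of the convex hull has hull neighbors, at least one of which differs from any
prescribed point. -/
lemma exists_hull_edge {X : Finset Pt} (hg : GenPos X) (hX : 2 < X.card) :
    ∃ u ∈ X, ∀ v ∈ X, v ≠ u → ∃ w ∈ X, w ≠ u ∧ w ≠ v ∧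
      ((∀ p ∈ X, p ≠ u → p ≠ w → 0 < cross u w p) ∨
        (∀ p ∈ X, p ≠ u → p ≠ w → cross u w p < 0)) := by
  classical
  obtain ⟨u, hu, hmax⟩ := X.exists_max_image (fun p => p.1 * p.1 + p.2 * p.2)
    (Finset.card_pos.1 (by omega))
  refine ⟨u, hu, fun v hv hvu => ?_⟩
  let y : Pt → ℝ := fun p => u.1 * (u.1 - p.1) + u.2 * (u.2 - p.2)
  let x : Pt → ℝ := fun p => u.1 * (p.2 - u.2) - u.2 * (p.1 - u.1)
  have hy : ∀ p ∈ X, p ≠ u → 0 < y p := by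
    intro p hp hpu
    have h := hmax p hp
    have : p.1 - u.1 ≠ 0 ∨ p.2 - u.2 ≠ 0 := by
      by_contra! h
      exact hpu (Prod.ext (by linarith [h.1]) (by linarith [h.2]))
    have : 0 < (p.1 - u.1) * (p.1 - u.1) + (p.2 - u.2) * (p.2 - u.2) := by
      rcases this with h | h
      · have := mul_self_pos.2 h
        linarith [mul_self_nonneg (p.2 - u.2)]
      · have := mul_self_pos.2 h
        linarith [mul_self_nonneg (p.1 - u.1)]
    simp only [y]
    linarith
  have hN : 0 < u.1 * u.1 + u.2 * u.2 := by
    have := hy v hv hvu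
    by_contra! h
    have h1 : u.1 = 0 := mul_self_eq_zero.1
      (by linarith [mul_self_nonneg u.1, mul_self_nonneg u.2])
    have h2 : u.2 = 0 := mul_self_eq_zero.1
      (by linarith [mul_self_nonneg u.1, mul_self_nonneg u.2])
    simp [y, h1, h2] at this
  have hid : ∀ p q, x q * y p - x p * y q = (u.1 * u.1 + u.2 * u.2) * cross u q p := by
    intro p q; simp only [x, y, cross]; ring
  let key : Pt → ℝ := fun p => x p / y p
  have hcross : ∀ p ∈ X, ∀ q ∈ X, p ≠ u → q ≠ u → p ≠ q → key q ≤ key p → cross u q p < 0 := by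
    intro p hp q hq hpu hqu hpq hle
    refine lt_of_le_of_ne ?_ (hg.cross_ne_zero hu hq hp hqu.symm hpu.symm hpq.symm)
    have h := (div_le_div_iff₀ (hy q hq hqu) (hy p hp hpu)).1 hle
    have h' := hid p q
    by_contra! hc
    have := mul_pos hN hc
    linarith
  have hanti : ∀ a b : Pt, cross u a b = - cross u b a := by
    intro a b; simp only [cross]; ring
  have hS : ((X.erase u).erase v).Nonempty := by
    have h1 := Finset.card_erase_add_one hu
    have h2 := Finset.card_erase_add_one (Finset.mem_erase.2 ⟨hvu, hv⟩)
    rw [← Finset.card_pos]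
    omega
  obtain ⟨w, hw, hwm⟩ := ((X.erase u).erase v).exists_min_image key hS
  obtain ⟨z, hz, hzm⟩ := ((X.erase u).erase v).exists_max_image key hS
  have hwz := hwm z hz
  simp only [Finset.mem_erase] at hw hz hwm hzm
  rcases le_or_gt (key w) (key v) with h | h
  · refine ⟨w, hw.2.2, hw.2.1, hw.1, Or.inr fun p hp hpu hpw => ?_⟩
    refine hcross p hp w hw.2.2 hpu hw.2.1 hpw ?_
    by_cases hpv : p = v
    · rwa [hpv]
    · exact hwm p ⟨hpv, hpu, hp⟩
  · refine ⟨z, hz.2.2, hz.2.1, hz.1, Or.inl fun p hp hpu hpz => ?_⟩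
    rw [hanti, neg_pos]
    refine hcross z hz.2.2 p hp hz.2.1 hpu (Ne.symm hpz) ?_
    by_cases hpv : p = v
    · rw [hpv]; linarith
    · exact hzm p ⟨hpv, hpu, hp⟩

end Geometry

section Elimination

lemma cross_swap (u v p : Pt) : cross v u p = - cross u v p := by
  simp only [cross]; ring

lemma cross_self_left (u v : Pt) : cross u v u = 0 := by simp [cross]

lemma cross_self_right (u v : Pt) : cross u v v = 0 := by simp only [cross]; ring

lemma HasAvoidingMatching.union_of_cross {X Y : Finset Pt} {H : Finset (Sym2 Pt)} {u v : Pt}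
    (hX : HasAvoidingMatching X H) (hY : HasAvoidingMatching Y H)
    (hXc : ∀ p ∈ X, cross u v p ≤ 0) (hYc : ∀ p ∈ Y, 0 < cross u v p) :
    HasAvoidingMatching (X ∪ Y) H := by
  refine hX.union hY (a := -(v.2 - u.2)) (b := v.1 - u.1)
    (c := -(v.2 - u.2) * u.1 + (v.1 - u.1) * u.2) ?_ ?_
  · intro p hp
    have := hXc p hp
    unfold cross at this
    linarith
  · intro p hp
    have := hYc p hp
    unfold cross at this
    linarith

lemma hasAvoidingMatching_of_half {X A : Finset Pt} {H : Finset (Sym2 Pt)} {n : ℕ}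
    (hg : GenPos X) (hX : X.card = 2 * n) (hAX : A ⊆ X) (hA : A.card = n)
    (hAH : ∀ a ∈ A, ∀ b ∈ X \ A, s(a, b) ∉ H) : HasAvoidingMatching X H := by
  have hu : A ∪ X \ A = X := Finset.union_sdiff_of_subset hAX
  have hc : (X \ A).card = n := by rw [Finset.card_sdiff_of_subset hAX]; omega
  rw [← hu]
  exact hasAvoidingMatching_of_bipartition Finset.disjoint_sdiff (by rw [hA, hc]) (by rwa [hu]) hAH

/-- If `H` is contained in a perfect matching of at least four points, it can be avoided. -/
lemma hasAvoidingMatching_of_pairs {β : Type*} [DecidableEq β] {X : Finset Pt}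
    {H : Finset (Sym2 Pt)} {n : ℕ} (hg : GenPos X) (hX : X.card = 2 * n) (hn : 1 < n) (c : Pt → β)
    (hcH : ∀ p q, s(p, q) ∈ H → c p = c q)
    (h2 : ∀ p ∈ X, (X.filter fun q => c q = c p).card = 2) : HasAvoidingMatching X H := by
  have hpartner : ∀ p ∈ X, ∃ q ∈ X, q ≠ p ∧ c q = c p ∧ ∀ r ∈ X, c r = c p → r = p ∨ r = q := by
    intro p hp
    obtain ⟨q, r, hqr, he⟩ := Finset.card_eq_two.1 (h2 p hp)
    have hmem : ∀ x, (x ∈ X ∧ c x = c p) ↔ x = q ∨ x = r := by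
      intro x
      have := Finset.ext_iff.1 he x
      simpa using this
    have h1 := (hmem p).1 ⟨hp, rfl⟩
    have hq := (hmem q).2 (Or.inl rfl)
    have hr := (hmem r).2 (Or.inr rfl)
    rcases h1 with rfl | rfl
    · exact ⟨r, hr.1, hqr.symm, hr.2, fun x hx hc => (hmem x).1 ⟨hx, hc⟩⟩
    · exact ⟨q, hq.1, hqr, hq.2, fun x hx hc => ((hmem x).1 ⟨hx, hc⟩).symm⟩
  obtain ⟨u, hu, hull⟩ := exists_hull_edge hg (by omega)
  obtain ⟨v, hv, hvu, hcv, hfib⟩ := hpartner u hu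
  obtain ⟨w, hw, hwu, hwv, hside⟩ := hull v hv hvu
  have hcw : c w ≠ c u := fun h => (hfib w hw h).elim hwu hwv
  set V := (X.erase u).erase w with hV
  have hVX : V ⊆ X := (Finset.erase_subset _ _).trans (Finset.erase_subset _ _)
  have hVcard : V.card = 2 * (n - 1) := by
    have h1 := Finset.card_erase_add_one hu
    have h2 := Finset.card_erase_add_one (Finset.mem_erase.2 ⟨hwu, hw⟩)
    rw [← hV] at h2
    omega
  have himage : V.image c = X.image c := by
    refine (Finset.image_subset_image hVX).antisymm fun i hi => ?_
    obtain ⟨p, hp, rfl⟩ := Finset.mem_image.1 hi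
    rw [Finset.mem_image]
    by_cases hpu : p = u
    · exact ⟨v, by simp [hV, hwv.symm, hvu, hv], by rw [hcv, hpu]⟩
    by_cases hpw : p = w
    · obtain ⟨w', hw', hww', hcw', -⟩ := hpartner w hw
      refine ⟨w', ?_, by rw [hcw', hpw]⟩
      have : w' ≠ u := by rintro rfl; exact hcw hcw'.symm
      simp [hV, hww', this, hw']
    · exact ⟨p, by simp [hV, hpw, hpu, hp], rfl⟩
  have hcard : (V.image c).card = n := by
    have h := Finset.card_eq_sum_card_image c X
    rw [Finset.sum_congr rfl (g := fun _ => 2)] at h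
    · simp only [Finset.sum_const, smul_eq_mul] at h
      rw [himage]
      omega
    · intro i hi
      obtain ⟨p, hp, rfl⟩ := Finset.mem_image.1 hi
      exact h2 p hp
  obtain ⟨A, hAV, hA, hAc⟩ := exists_half_of_many_labels (by omega) hVcard c (by omega)
  have hVM : HasAvoidingMatching V H := hasAvoidingMatching_of_half (hg.mono hVX) hVcard hAV hA
    fun a ha b hb h => hAc a ha b hb (hcH a b h)
  have hsub : ({u} ∪ {w} : Finset Pt) ⊆ X := by
    intro p hp
    simp only [Finset.mem_union, Finset.mem_singleton] at hp
    rcases hp with rfl | rfl <;> assumption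
  have hUM : HasAvoidingMatching ({u} ∪ {w}) H := by
    refine hasAvoidingMatching_of_bipartition (by simpa using hwu.symm) (by simp) (hg.mono hsub) ?_
    simp only [Finset.mem_singleton]
    rintro _ rfl _ rfl h
    exact hcw (hcH _ _ h).symm
  have hXeq : X = ({u} ∪ {w}) ∪ V := by
    ext p
    simp only [hV, Finset.mem_union, Finset.mem_singleton, Finset.mem_erase]
    grind
  have hVm : ∀ p ∈ V, p ∈ X ∧ p ≠ u ∧ p ≠ w := by
    intro p hp
    simp only [hV, Finset.mem_erase] at hp
    tauto
  rw [hXeq]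
  rcases hside with h | h
  · refine hUM.union_of_cross hVM (u := u) (v := w) ?_ fun p hp => ?_
    · simp [cross_self_left, cross_self_right]
    · obtain ⟨h1, h2, h3⟩ := hVm p hp
      exact h p h1 h2 h3
  · refine hUM.union_of_cross hVM (u := w) (v := u) ?_ fun p hp => ?_
    · simp [cross_self_left, cross_self_right]
    · obtain ⟨h1, h2, h3⟩ := hVm p hp
      rw [cross_swap, neg_pos]
      exact h p h1 h2 h3

lemma hasAvoidingMatching_of_one_sided {X F P Q : Finset Pt} {H : Finset (Sym2 Pt)} {n : ℕ}
    (hg : GenPos X) (hX : X.card = 2 * n) (hFX : F ⊆ X) (hF : F.card = n + 1)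
    (hHF : ∀ p q, s(p, q) ∈ H → p ∈ F ∧ q ∈ F) (hPF : P ⊆ F) (hQF : Q ⊆ F) (hPQ : Disjoint P Q)
    (hc : P.card = Q.card) (hP : 0 < P.card) (hPQH : ∀ p ∈ P, ∀ q ∈ Q, s(p, q) ∉ H) {u v : Pt}
    (hpos : ∀ p ∈ P ∪ Q, 0 < cross u v p) (hneg : ∀ p ∈ X \ (P ∪ Q), cross u v p ≤ 0) :
    HasAvoidingMatching X H := by
  have hPQF : P ∪ Q ⊆ F := Finset.union_subset hPF hQF
  have hPQc : (P ∪ Q).card = 2 * P.card := by rw [Finset.card_union_of_disjoint hPQ]; omega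
  have hle := Finset.card_le_card hPQF
  have hXF : (X \ F).card + (n + 1) = 2 * n := by
    have := Finset.card_sdiff_add_card_eq_card hFX
    omega
  obtain ⟨S, hS, hSc⟩ := Finset.exists_subset_card_eq (s := X \ F) (n := P.card - 1) (by omega)
  have hSF : ∀ p ∈ S, p ∈ X ∧ p ∉ F := fun p hp => Finset.mem_sdiff.1 (hS hp)
  have hY : HasAvoidingMatching (X \ (P ∪ Q)) H := by
    refine hasAvoidingMatching_of_half (A := (F \ (P ∪ Q)) ∪ S) (n := n - P.card)
      (hg.mono Finset.sdiff_subset) ?_ ?_ ?_ ?_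
    · rw [Finset.card_sdiff_of_subset (hPQF.trans hFX)]
      omega
    · intro p hp
      rcases Finset.mem_union.1 hp with h | h
      · exact Finset.sdiff_subset_sdiff hFX subset_rfl h
      · exact Finset.mem_sdiff.2 ⟨(hSF p h).1, fun h' => (hSF p h).2 (hPQF h')⟩
    · rw [Finset.card_union_of_disjoint, Finset.card_sdiff_of_subset hPQF]
      · omega
      · rw [Finset.disjoint_left]
        intro p hp hpS
        exact (hSF p hpS).2 (Finset.mem_sdiff.1 hp).1
    · intro a _ b hb hab
      have hbF := (hHF a b hab).2
      simp only [Finset.mem_sdiff, Finset.mem_union] at hb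
      tauto
  have hZ : HasAvoidingMatching (P ∪ Q) H :=
    hasAvoidingMatching_of_bipartition hPQ hc (hg.mono (hPQF.trans hFX)) hPQH
  have := hY.union_of_cross hZ hneg hpos
  rwa [Finset.sdiff_union_of_subset (hPQF.trans hFX)] at this

/-- Balance of the left side when `s(u, v)` is the only edge of `H` between the disjoint sets
`F ∋ u` and `G ∋ v`, and all other edges of `H` lie inside `F` or inside `G`. -/
lemma card_filter_left_eq {X F G : Finset Pt} {H : Finset (Sym2 Pt)} {n : ℕ}
    (hg : GenPos X) (hX : X.card = 2 * n) (helim : ¬ HasAvoidingMatching X H)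
    (hFX : F ⊆ X) (hGX : G ⊆ X) (hFG : Disjoint F G) (hc : F.card + G.card = n + 1) {u v : Pt}
    (hu : u ∈ F) (hv : v ∈ G)
    (hH : ∀ p q, s(p, q) ∈ H → (p ∈ F ∧ q ∈ F) ∨ (p ∈ G ∧ q ∈ G) ∨ (p = u ∧ q = v) ∨
      (p = v ∧ q = u)) :
    ((F ∪ G).filter fun p => 0 < cross u v p).card =
      ((X \ (F ∪ G)).filter fun p => 0 < cross u v p).card := by
  have huv : u ≠ v := fun h => Finset.disjoint_left.1 hFG hu (h ▸ hv)
  have huL : ¬ 0 < cross u v u := by simp [cross_self_left]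
  have hvL : ¬ 0 < cross u v v := by simp [cross_self_right]
  set K := X \ (F ∪ G) with hK
  have hFGX : F ∪ G ⊆ X := Finset.union_subset hFX hGX
  have hFGc : (F ∪ G).card = n + 1 := by rw [Finset.card_union_of_disjoint hFG, hc]
  have hKX : K ⊆ X := Finset.sdiff_subset
  have hKc : K.card + (n + 1) = 2 * n := by
    rw [← hX, ← hFGc]; exact Finset.card_sdiff_add_card_eq_card hFGX
  have hKF : Disjoint F K := Finset.disjoint_left.2 fun p hp h =>
    (Finset.mem_sdiff.1 h).2 (Finset.mem_union_left _ hp)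
  have hKG : Disjoint G K := Finset.disjoint_left.2 fun p hp h =>
    (Finset.mem_sdiff.1 h).2 (Finset.mem_union_right _ hp)
  have hFpos : 0 < F.card := Finset.card_pos.2 ⟨u, hu⟩
  have hGpos : 0 < G.card := Finset.card_pos.2 ⟨v, hv⟩
  have hHFG : ∀ p ∈ F, ∀ q ∈ G, s(p, q) ∈ H → p = u ∧ q = v := by
    intro p hp q hq h
    have h1 := Finset.disjoint_left.1 hFG hp
    have h2 := Finset.disjoint_right.1 hFG hq
    rcases hH p q h with h | h | h | ⟨rfl, -⟩
    · exact absurd h.2 h2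
    · exact absurd h.1 h1
    · exact h
    · exact absurd hv h1
  have hHin : ∀ p q, s(p, q) ∈ H → p ∈ F ∪ G ∧ q ∈ F ∪ G := by
    intro p q h
    simp only [Finset.mem_union]
    rcases hH p q h with h | h | ⟨rfl, rfl⟩ | ⟨rfl, rfl⟩ <;> tauto
  rw [Finset.filter_union, Finset.card_union_of_disjoint (Finset.disjoint_filter_filter hFG)]
  have key : ∀ S ⊆ K, S.card + 1 = G.card →
      (F.filter (0 < cross u v ·)).card + (S.filter (0 < cross u v ·)).card = (G.filter (0 < cross u v ·)).card + ((K \ S).filter (0 < cross u v ·)).card := by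
    intro S hS hSc
    have hFS : Disjoint F S := hKF.mono_right hS
    have hGT : Disjoint G (K \ S) := hKG.mono_right Finset.sdiff_subset
    have hdis : Disjoint (F ∪ S) (G ∪ K \ S) := by
      rw [Finset.disjoint_union_left, Finset.disjoint_union_right, Finset.disjoint_union_right]
      exact ⟨⟨hFG, hKF.mono_right Finset.sdiff_subset⟩,
        (hKG.mono_right hS).symm, Finset.disjoint_sdiff⟩
    have hun : (F ∪ S) ∪ (G ∪ K \ S) = X := by
      rw [← Finset.sdiff_union_of_subset hFGX, ← hK, ← Finset.sdiff_union_of_subset hS]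
      ext p
      simp only [Finset.mem_union, Finset.mem_sdiff]
      tauto
    by_contra hne
    refine helim ?_
    have hTc := Finset.card_sdiff_add_card_eq_card hS
    rw [← hun]
    refine hasAvoidingMatching_of_unbalanced hdis ?_ (by rwa [hun]) (Finset.mem_union_left _ hu)
      (Finset.mem_union_left _ hv) ?_ ?_
    · rw [Finset.card_union_of_disjoint hFS, Finset.card_union_of_disjoint hGT]
      omega
    · intro a ha b hb hab
      have hin := hHin a b hab
      have hnK : ∀ p ∈ F ∪ G, p ∉ K := fun p hp h => (Finset.mem_sdiff.1 h).2 hp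
      refine hHFG a ((Finset.mem_union.1 ha).resolve_right fun h => hnK a hin.1 (hS h)) b
        ((Finset.mem_union.1 hb).resolve_right fun h => hnK b hin.2 (Finset.sdiff_subset h)) hab
    · rw [Finset.filter_union, Finset.filter_union,
        Finset.card_union_of_disjoint (Finset.disjoint_filter_filter hFS),
        Finset.card_union_of_disjoint (Finset.disjoint_filter_filter hGT)]
      exact hne
  by_cases hG1 : G.card = 1
  · have h := key ∅ (by simp) (by simp [hG1])
    have hG0 : G.filter (0 < cross u v ·) = ∅ := by
      rw [Finset.filter_eq_empty_iff]
      intro p hp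
      rwa [Finset.card_le_one.1 hG1.le p hp v hv]
    simp only [hG0, Finset.filter_empty, Finset.card_empty, Finset.sdiff_empty] at h ⊢
    omega
  by_cases hF1 : F.card = 1
  · have h := key K subset_rfl (by omega)
    have hF0 : F.filter (0 < cross u v ·) = ∅ := by
      rw [Finset.filter_eq_empty_iff]
      intro p hp
      rwa [Finset.card_le_one.1 hF1.le p hp u hu]
    simp only [hF0, Finset.filter_empty, Finset.card_empty, Finset.sdiff_self] at h ⊢
    omega
  have hcross : ∀ p ∈ X, p ≠ u → p ≠ v → cross u v p ≠ 0 := fun p hp hpu hpv =>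
    hg.cross_ne_zero (hFX hu) (hGX hv) hp huv hpu.symm hpv.symm
  have hside : ∀ u' v' : Pt, ¬ 0 < cross u' v' u → (∀ p ∈ K, cross u' v' p ≤ 0) →
      (F.filter (0 < cross u' v' ·)).card = (G.filter (0 < cross u' v' ·)).card →
      (F.filter (0 < cross u' v' ·)).card = 0 := by
    intro u' v' hu' hK' he
    by_contra hpos
    refine helim (hasAvoidingMatching_of_one_sided hg hX hFGX hFGc hHin
      ((Finset.filter_subset _ _).trans Finset.subset_union_left)
      ((Finset.filter_subset _ _).trans Finset.subset_union_right)
      (Finset.disjoint_filter_filter hFG) he (Nat.pos_of_ne_zero hpos) ?_ (u := u') (v := v') ?_ ?_)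
    · intro p hp q hq hpq
      rw [Finset.mem_filter] at hp hq
      obtain ⟨rfl, -⟩ := hHFG p hp.1 q hq.1 hpq
      exact hu' hp.2
    · intro p hp
      rcases Finset.mem_union.1 hp with h | h <;> exact (Finset.mem_filter.1 h).2
    · intro p hp
      obtain ⟨hpX, hpn⟩ := Finset.mem_sdiff.1 hp
      by_cases hpK : p ∈ K
      · exact hK' p hpK
      · have hpFG : p ∈ F ∪ G := by
          by_contra h
          exact hpK (Finset.mem_sdiff.2 ⟨hpX, h⟩)
        by_contra! h
        simp only [Finset.mem_union, Finset.mem_filter] at hpn hpFG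
        tauto
  obtain ⟨S, hS, hSc⟩ := Finset.exists_subset_card_eq (s := K) (n := G.card - 1) (by omega)
  have hSkey := key S hS (by omega)
  have hTc := Finset.card_sdiff_add_card_eq_card hS
  by_cases hall : ∀ p ∈ K, 0 < cross u v p
  · rw [Finset.filter_true_of_mem fun p hp => hall p (hS hp),
      Finset.filter_true_of_mem fun p hp => hall p (Finset.sdiff_subset hp)] at hSkey
    rw [Finset.filter_true_of_mem hall]
    have hsplit : ∀ T : Finset Pt, ∀ x ∈ T, cross u v x = 0 →
        (∀ p ∈ T, p ≠ x → cross u v p ≠ 0) →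
        (T.filter (0 < cross u v ·)).card + (T.filter (0 < cross v u ·)).card + 1 = T.card := by
      intro T x hx hx0 hT
      rw [← Finset.card_union_of_disjoint, ← Finset.card_erase_add_one hx]
      · congr 2
        ext p
        simp only [Finset.mem_union, Finset.mem_filter, Finset.mem_erase, cross_swap u v, neg_pos]
        constructor
        · rintro (⟨h1, h2⟩ | ⟨h1, h2⟩)
          · exact ⟨by rintro rfl; exact h2.ne' hx0, h1⟩
          · exact ⟨by rintro rfl; exact h2.ne hx0, h1⟩
        · rintro ⟨h1, h2⟩
          rcases lt_or_gt_of_ne (hT p h2 h1) with h | h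
          · exact Or.inr ⟨h2, h⟩
          · exact Or.inl ⟨h2, h⟩
      · rw [Finset.disjoint_left]
        simp only [Finset.mem_filter, cross_swap u v, neg_pos]
        rintro p ⟨-, h1⟩ ⟨-, h2⟩
        exact h1.not_gt h2
    have h1 := hsplit F u hu (cross_self_left u v) fun p hp hpu => hcross p (hFX hp) hpu
      fun h => Finset.disjoint_left.1 hFG hp (h ▸ hv)
    have h2 := hsplit G v hv (cross_self_right u v) fun p hp hpv => hcross p (hGX hp)
      (fun h => Finset.disjoint_left.1 hFG hu (h ▸ hp)) hpv
    have h3 := hside v u (by simp [cross_self_right]) (fun p hp => by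
      rw [cross_swap, neg_nonpos]; exact (hall p hp).le) (by omega)
    omega
  by_cases hnone : ∀ p ∈ K, ¬ 0 < cross u v p
  · rw [Finset.filter_false_of_mem fun p hp => hnone p (hS hp),
      Finset.filter_false_of_mem fun p hp => hnone p (Finset.sdiff_subset hp)] at hSkey
    rw [Finset.filter_false_of_mem hnone]
    have h3 := hside u v huL (fun p hp => not_lt.1 (hnone p hp)) (by simpa using hSkey)
    simp only [Finset.card_empty] at hSkey ⊢
    omega
  exfalso
  push Not at hall hnone
  obtain ⟨q, hq, hqL⟩ := hall
  obtain ⟨p, hp, hpL⟩ := hnone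
  have hpq : p ≠ q := by rintro rfl; linarith
  have hcard : ((K.erase p).erase q).card + 2 = K.card := by
    have h1 := Finset.card_erase_add_one hp
    have h2 := Finset.card_erase_add_one (Finset.mem_erase.2 ⟨hpq.symm, hq⟩)
    omega
  obtain ⟨T, hT, hTc'⟩ := Finset.exists_subset_card_eq (s := (K.erase p).erase q)
    (n := G.card - 2) (by omega)
  have hTK : ∀ x ∈ T, x ∈ K ∧ x ≠ p ∧ x ≠ q := fun x hx => by
    have := hT hx
    simp only [Finset.mem_erase] at this
    tauto
  have hpT : p ∉ T := fun h => (hTK p h).2.1 rfl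
  have hqT : q ∉ T := fun h => (hTK q h).2.2 rfl
  have hsub : ∀ x ∈ K, insert x T ⊆ K := fun x hx =>
    Finset.insert_subset hx fun y hy => (hTK y hy).1
  have hcount : ∀ x ∈ K, x ∉ T →
      (F.filter (0 < cross u v ·)).card + 2 * ((insert x T).filter (0 < cross u v ·)).card =
        (G.filter (0 < cross u v ·)).card + (K.filter (0 < cross u v ·)).card := by
    intro x hx hxT
    have h := key (insert x T) (hsub x hx) (by rw [Finset.card_insert_of_notMem hxT]; omega)
    have h' := Finset.card_union_of_disjoint (Finset.disjoint_filter_filter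
      (p := (0 < cross u v ·)) (q := (0 < cross u v ·))
      (Finset.sdiff_disjoint (s := insert x T) (t := K)))
    rw [← Finset.filter_union, Finset.sdiff_union_of_subset (hsub x hx)] at h'
    omega
  have h1 := hcount p hp hpT
  have h2 := hcount q hq hqT
  rw [Finset.filter_insert, if_pos hpL, Finset.card_insert_of_notMem (by simp [hpT])] at h1
  rw [Finset.filter_insert, if_neg hqL.not_gt] at h2
  omega

/-- Structure of an eliminating edge set with half as many edges as there are points: removing
one edge from it leaves two trees which together span the red points. -/
lemma exists_color_classes {n : ℕ} {X : Finset Pt} (hX : X.card = 2 * n) (hg : GenPos X)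
    {H : Finset (Sym2 Pt)} (hH : ∀ e ∈ H, IsEdgeOf X e) (hHc : H.card = n)
    (helim : ¬ HasAvoidingMatching X H) {u v : Pt} (huv : s(u, v) ∈ H) :
    ∃ F G : Finset Pt, F ⊆ X ∧ G ⊆ X ∧ Disjoint F G ∧ F.card + G.card = n + 1 ∧ u ∈ F ∧ v ∈ G ∧
      (∀ p q, s(p, q) ∈ H → (p ∈ F ∧ q ∈ F) ∨ (p ∈ G ∧ q ∈ G) ∨ (p = u ∧ q = v) ∨
        (p = v ∧ q = u)) ∧ ∀ p ∈ X, RedPt H p ↔ p ∈ F ∪ G := by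
  have hn : 0 < n := hHc ▸ Finset.card_pos.2 ⟨_, huv⟩
  have huX : u ∈ X := (hH _ huv).2 u (by simp)
  have hvX : v ∈ X := (hH _ huv).2 v (by simp)
  have hne : u ≠ v := by simpa using (hH _ huv).1
  obtain ⟨c', hc', hcard'⟩ := exists_labeling X (H.erase s(u, v))
  rw [Finset.card_erase_of_mem huv, hX, hHc] at hcard'
  have hc'H : ∀ p q, s(p, q) ∈ H → c' p = c' q ∨ (p = u ∧ q = v) ∨ (p = v ∧ q = u) := by
    intro p q h
    by_cases he : s(p, q) = s(u, v)
    · exact Or.inr (Sym2.eq_iff.1 he)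
    · exact Or.inl (hc' p q (Finset.mem_erase.2 ⟨he, h⟩))
  have hhalf : ∀ c : Pt → Pt, (∀ p q, s(p, q) ∈ H → c p = c q) →
      ¬ ∃ A ⊆ X, A.card = n ∧ ∀ p ∈ A, ∀ q ∈ X \ A, c p ≠ c q := by
    rintro c hc ⟨A, hAX, hA, hAc⟩
    exact helim (hasAvoidingMatching_of_half hg hX hAX hA fun a ha b hb h =>
      hAc a ha b hb (hc a b h))
  have hcuv : c' u ≠ c' v := by
    intro h
    refine hhalf c' (fun p q hpq => ?_) (exists_half_of_many_labels hn hX c' (by omega))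
    rcases hc'H p q hpq with h' | ⟨rfl, rfl⟩ | ⟨rfl, rfl⟩
    · exact h'
    · exact h
    · exact h.symm
  obtain ⟨c, hc⟩ : ∃ c : Pt → Pt, c = fun x => if c' x = c' u then c' v else c' x := ⟨_, rfl⟩
  have hcH : ∀ p q, s(p, q) ∈ H → c p = c q := by
    intro p q hpq
    rw [hc]
    rcases hc'H p q hpq with h | ⟨rfl, rfl⟩ | ⟨rfl, rfl⟩
    · simp [h]
    · simp
    · simp
  have hcard : n ≤ (X.image c).card := by
    have := card_image_le_merge X c' (c' u) (c' v)
    rw [hc]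
    omega
  have hfib : (X.filter fun q => c q = c u).card = n + 1 ∧
      ∀ p ∈ X, c p ≠ c u → (X.filter fun q => c q = c p).card = 1 := by
    rcases exists_half_or_of_labels hn hX c hcard with h | h | ⟨p₀, hp₀, h1, h2⟩
    · exact absurd h (hhalf c hcH)
    · obtain rfl | hn1 : n = 1 ∨ 1 < n := by omega
      · refine ⟨h u huX, fun p hp hpu => absurd ?_ hpu⟩
        have := Finset.eq_of_subset_of_card_le (Finset.filter_subset (fun q => c q = c u) X)
          (by rw [h u huX, hX])
        rw [← this] at hp
        exact (Finset.mem_filter.1 hp).2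
      · exact absurd (hasAvoidingMatching_of_pairs hg hX hn1 c hcH h) helim
    · have : c u = c p₀ := by
        by_contra hne'
        have h3 := h2 u huX hne'
        exact hne (Finset.card_le_one.1 h3.le u (by simp [huX]) v (by simp [hvX, hcH u v huv]))
      rw [this]
      exact ⟨h1, h2⟩
  have hcu : ∀ p, c p = c u ↔ c' p = c' u ∨ c' p = c' v := by
    intro p
    simp only [hc, if_true]
    by_cases h : c' p = c' u <;> simp [h]
  have hFG : X.filter (fun q => c q = c u) =
      (X.filter fun q => c' q = c' u) ∪ X.filter fun q => c' q = c' v := by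
    rw [← Finset.filter_or]
    exact Finset.filter_congr fun p _ => hcu p
  have hHin : ∀ p q, s(p, q) ∈ H → c p = c u := by
    intro p q hpq
    by_contra hpu
    have hpX : p ∈ X := (hH _ hpq).2 p (by simp)
    have hqX : q ∈ X := (hH _ hpq).2 q (by simp)
    have hpq' : p ≠ q := by simpa using (hH _ hpq).1
    exact hpq' (Finset.card_le_one.1 (hfib.2 p hpX hpu).le p (by simp [hpX]) q
      (by simp [hqX, hcH p q hpq]))
  have hdisj : Disjoint (X.filter fun q => c' q = c' u) (X.filter fun q => c' q = c' v) := by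
    rw [Finset.disjoint_left]
    intro p hp hq
    rw [Finset.mem_filter] at hp hq
    exact hcuv (hp.2.symm.trans hq.2)
  refine ⟨X.filter fun q => c' q = c' u, X.filter fun q => c' q = c' v, Finset.filter_subset _ _,
    Finset.filter_subset _ _, hdisj, ?_, by simp [huX], by simp [hvX], ?_, ?_⟩
  · rw [← Finset.card_union_of_disjoint hdisj, ← hFG, hfib.1]
  · intro p q hpq
    have hpX : p ∈ X := (hH _ hpq).2 p (by simp)
    have hqX : q ∈ X := (hH _ hpq).2 q (by simp)
    rcases hc'H p q hpq with h | h
    · rcases (hcu p).1 (hHin p q hpq) with h' | h'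
      · left
        simp [hpX, hqX, ← h, h']
      · right; left
        simp [hpX, hqX, ← h, h']
    · exact Or.inr (Or.inr h)
  · intro p hp
    rw [← hFG, Finset.mem_filter]
    constructor
    · rintro ⟨e, he, hpe⟩
      obtain ⟨q, rfl⟩ := hpe
      exact ⟨hp, hHin p q he⟩
    · rintro ⟨-, hpu⟩
      by_contra hred
      refine helim (hasAvoidingMatching_of_half hg hX
        (A := (X.filter fun q => c q = c u).erase p)
        ((Finset.erase_subset _ _).trans (Finset.filter_subset _ _)) ?_ ?_)
      · rw [Finset.card_erase_of_mem (by simp [hp, hpu]), hfib.1, Nat.add_sub_cancel]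
      · intro a ha b hb hab
        simp only [Finset.mem_sdiff, Finset.mem_erase, Finset.mem_filter] at ha hb
        by_cases hbp : b = p
        · exact hred ⟨_, hab, by simp [hbp]⟩
        · exact hb.2 ⟨hbp, hb.1, (hcH a b hab).symm.trans ha.2.2⟩

lemma ncard_red_left_eq_ncard_blue_left {n : ℕ} {X : Finset Pt} (hX : X.card = 2 * n)
    (hg : GenPos X) {H : Finset (Sym2 Pt)} (hH : ∀ e ∈ H, IsEdgeOf X e) (hHc : H.card = n)
    (helim : ¬ HasAvoidingMatching X H) {u v : Pt} (huv : s(u, v) ∈ H) :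
    {p ∈ (X : Set Pt) | RedPt H p ∧ 0 < cross u v p}.ncard
      = {p ∈ (X : Set Pt) | ¬ RedPt H p ∧ 0 < cross u v p}.ncard := by
  obtain ⟨F, G, hFX, hGX, hFG, hc, hu, hv, hHFG, hred⟩ :=
    exists_color_classes hX hg hH hHc helim huv
  have h := card_filter_left_eq hg hX helim hFX hGX hFG hc hu hv hHFG
  rw [← Set.ncard_coe_finset, ← Set.ncard_coe_finset] at h
  convert h using 2
  · ext p
    simp only [Set.mem_ofPred_eq, Finset.mem_coe, Finset.mem_filter]
    constructor
    · rintro ⟨hp, hr, hL⟩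
      exact ⟨(hred p hp).1 hr, hL⟩
    · rintro ⟨hp, hL⟩
      have hpX := Finset.union_subset hFX hGX hp
      exact ⟨hpX, (hred p hpX).2 hp, hL⟩
  · ext p
    simp only [Set.mem_ofPred_eq, Finset.mem_coe, Finset.mem_filter, Finset.mem_sdiff]
    constructor
    · rintro ⟨hp, hr, hL⟩
      exact ⟨⟨hp, fun h => hr ((hred p hp).2 h)⟩, hL⟩
    · rintro ⟨⟨hp, hn⟩, hL⟩
      exact ⟨hp, fun h => hn ((hred p hp).1 h), hL⟩

end Elimination

/-- Lemma, part (c): if removing a set `H` of exactly `n` edges eliminates all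
non-crossing perfect matchings, then for every edge `{u,v} ∈ H`, on each open half-plane
determined by the line through `u` and `v` the number of red points equals the number of blue
points. -/
theorem balanced_sides_of_eliminating_edge (n : ℕ) (X : Finset Pt)
    (hXcard : X.card = 2 * n) (hgp : GenPos X)
    (H : Finset (Sym2 Pt)) (hH : ∀ e ∈ H, IsEdgeOf X e) (hHcard : H.card = n)
    (helim : ∀ M : Finset (Sym2 Pt), IsNCMatching X M → ¬ Avoids M H)
    (u v : Pt) (huv : s(u, v) ∈ H) :
    ({p ∈ (X : Set Pt) | RedPt H p ∧ 0 < cross u v p}.ncard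
        = {p ∈ (X : Set Pt) | ¬ RedPt H p ∧ 0 < cross u v p}.ncard) ∧
    ({p ∈ (X : Set Pt) | RedPt H p ∧ cross u v p < 0}.ncard
        = {p ∈ (X : Set Pt) | ¬ RedPt H p ∧ cross u v p < 0}.ncard) := by
  have helim' : ¬ HasAvoidingMatching X H := fun ⟨M, hM, hMH⟩ => helim M hM hMH
  refine ⟨ncard_red_left_eq_ncard_blue_left hXcard hgp hH hHcard helim' huv, ?_⟩
  have h := ncard_red_left_eq_ncard_blue_left hXcard hgp hH hHcard helim' (Sym2.eq_swap ▸ huv)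
  simpa only [cross_swap u v, neg_pos] using h
end
end
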